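/- arXiv:1902.01381 — 2 statements merged into one kernel-verified Lean document; each statement's English description precedes it below -/
import Mathlib

section
/- Assume ε > 0, ℓ ∈ ℕ, and for every 1 ≤ i ≤ ℓ fix N_i ∈ ℕ^d, v_i ∈ ℤ^d, an m-dimensional weight α_i and an n-dimensional weight β_i, where d = m + n. Assume κ_1, …, κ_ℓ are positive real numbers such that for all 2 ≤ i ≤ ℓ the vector κ_i(α_i, β_i) − κ_{i−1}(α_{i−1}, β_{i−1}) has all coordinates positive, i.e., κ_i α_{i,j} > κ_{i−1} α_{i−1,j} for all 1 ≤ j ≤ m and κ_i β_{i,j} > κ_{i−1} β_{i−1,j} for all 1 ≤ j ≤ n. Then for Lebesgue-almost every real m×n matrix θ there exist arbitrarily large Q ∈ ℝ such that for every 1 ≤ i ≤ ℓ there exists (p_i, q_i) ∈ ℤ^m × ℤ^n satisfying: (1) ‖θq_i + p_i‖_{α_i} ≤ ε Q^{-κ_i} and ‖q_i‖_{β_i} ≤ ε Q^{κ_i}; (2) p_{i,j} ≡ v_{i,j} (mod N_{i,j}) for every 1 ≤ j ≤ m and q_{i,j} ≡ v_{i,m+j} (mod N_{i,m+j}) for every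 1 ≤ j ≤ n. -/
open MeasureTheory

/-- The quasi-norm associated with a weight `α` on `ℝ^k`:
`‖x‖_α = max_j |x j| ^ (1 / α j)`. -/
noncomputable def quasiNorm {k : ℕ} (α : Fin k → ℝ) (x : Fin k → ℝ) : ℝ :=
  ⨆ j, |x j| ^ (1 / α j)

section

open Metric Set Filter Topology Matrix
open scoped ENNReal

set_option linter.unusedSectionVars false

section Lattice

variable {J : Type*} [Fintype J]

/-- Every nonzero vector of the lattice `L ℤ^J` has sup norm at least `η`. -/
def SystoleGE (η : ℝ) (L : Matrix J J ℝ) : Prop :=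
  ∀ w : J → ℤ, w ≠ 0 → η ≤ ‖L *ᵥ fun i => (w i : ℝ)‖

/-- The set of points of the lattice `L ℤ^J`. -/
def latticePoints (L : Matrix J J ℝ) : Set (J → ℝ) :=
  range fun w : J → ℤ => L *ᵥ fun i => (w i : ℝ)

lemma infDist_add_latticePoints (L : Matrix J J ℝ) (x : J → ℝ) (w : J → ℤ) :
    infDist (x + L *ᵥ fun i => (w i : ℝ)) (latticePoints L) = infDist x (latticePoints L) := by
  have key : ∀ (x : J → ℝ) (w : J → ℤ),
      infDist (x + L *ᵥ fun i => (w i : ℝ)) (latticePoints L) ≤ infDist x (latticePoints L) := by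
    intro x w
    refine (le_infDist ⟨_, mem_range_self (0 : J → ℤ)⟩).2 ?_
    rintro _ ⟨w', rfl⟩
    refine (infDist_le_dist_of_mem (mem_range_self (w' + w))).trans ?_
    have : (L *ᵥ fun i => (((w' + w) i : ℤ) : ℝ)) =
        (L *ᵥ fun i => (w' i : ℝ)) + L *ᵥ fun i => (w i : ℝ) := by
      rw [← mulVec_add]; congr 1; ext i; simp
    rw [this, dist_add_right]
  refine le_antisymm (key x w) ?_
  have h := key (x + L *ᵥ fun i => (w i : ℝ)) (-w)
  have : (L *ᵥ fun i => (((-w) i : ℤ) : ℝ)) = -(L *ᵥ fun i => (w i : ℝ)) := by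
    rw [← mulVec_neg]; congr 1; ext i; simp
  rwa [this, add_neg_cancel_right] at h

lemma exists_int_sub_mem [DecidableEq J] {S : Set (J → ℝ)} (hS : MeasurableSet S)
    (hvol : 1 < volume S) :
    ∃ x ∈ S, ∃ w : J → ℤ, w ≠ 0 ∧ x + (fun i => (w i : ℝ)) ∈ S := by
  have hF : volume (ZSpan.fundamentalDomain (Pi.basisFun ℝ J)) = 1 := by
    rw [ZSpan.volume_fundamentalDomain]
    have : Matrix.of (Pi.basisFun ℝ J) = 1 := by
      ext i j; simp [Pi.single_apply, Matrix.one_apply, eq_comm]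
    rw [this]; simp
  have : Countable (Submodule.span ℤ (Set.range (Pi.basisFun ℝ J))).toAddSubgroup :=
    inferInstanceAs (Countable (Submodule.span ℤ (Set.range (Pi.basisFun ℝ J))))
  obtain ⟨a, b, hab, h⟩ := exists_pair_mem_lattice_not_disjoint_vadd
    (ZSpan.isAddFundamentalDomain' (Pi.basisFun ℝ J) volume) hS.nullMeasurableSet (hF ▸ hvol)
  rw [Set.not_disjoint_iff] at h
  obtain ⟨_, ⟨x, hx, rfl⟩, ⟨y, hy, hxy⟩⟩ := h
  have hxy : (b : J → ℝ) + y = a + x := hxy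
  have hmem : (a - b : J → ℝ) ∈
      Submodule.span ℤ (Set.range (Pi.basisFun ℝ J)) := sub_mem a.2 b.2
  rw [Module.Basis.mem_span_iff_repr_mem] at hmem
  choose w hw using hmem
  have hw' : (fun i => (w i : ℝ)) = (a : J → ℝ) - b := by
    ext i; simpa using hw i
  refine ⟨x, hx, w, ?_, ?_⟩
  · rintro rfl
    apply hab
    apply Subtype.ext
    have : (a : J → ℝ) - b = 0 := by rw [← hw']; ext i; simp
    exact sub_eq_zero.1 this
  · rw [hw']
    convert hy using 1
    rw [← add_right_inj (b : J → ℝ), hxy]; abel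

/-- Covering radius bound: a unimodular lattice with shortest vector at least `η` is
`ρ`-dense with `ρ` depending only on `η`. -/
lemma SystoleGE.exists_covering (J : Type*) [Fintype J] [DecidableEq J] {η : ℝ} (hη : 0 < η) :
    ∃ ρ > 0, ∀ L : Matrix J J ℝ, L.det = 1 → SystoleGE η L →
      ∀ y : J → ℝ, ∃ w : J → ℤ, ‖y - L *ᵥ fun i => (w i : ℝ)‖ ≤ ρ := by
  obtain ⟨K, hK⟩ := exists_nat_gt (1 / η ^ Fintype.card J)
  refine ⟨K * η + 1, by positivity, fun L hdet hL y => ?_⟩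
  have hne : (latticePoints L).Nonempty := ⟨_, mem_range_self (0 : J → ℤ)⟩
  suffices hD : infDist y (latticePoints L) ≤ K * η by
    obtain ⟨_, ⟨w, rfl⟩, hw⟩ := (infDist_lt_iff hne).1 (lt_of_le_of_lt hD (lt_add_one _))
    exact ⟨w, by rw [← dist_eq_norm]; exact hw.le⟩
  by_contra! hD
  set f : (J → ℝ) → ℝ := fun x => infDist x (latticePoints L) with hf
  have hfdist : ∀ x x', |f x - f x'| ≤ dist x x' := fun x x' => by
    rw [← Real.dist_eq]
    simpa using (lipschitz_infDist_pt (latticePoints L)).dist_le_mul x x'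
  have hex : ∀ k : Fin K, ∃ x, f x = k * η := by
    intro k
    have hcont : ContinuousOn (fun t : ℝ => f (t • y)) (Icc 0 1) :=
      ((continuous_infDist_pt _).comp (by fun_prop)).continuousOn
    have h0 : f ((0 : ℝ) • y) = 0 := by
      rw [zero_smul]
      exact infDist_zero_of_mem ⟨0, by ext i; simp [mulVec, dotProduct]⟩
    have hk : (k : ℝ) ≤ K := by exact_mod_cast k.2.le
    have := intermediate_value_Icc zero_le_one hcont
      (show (k : ℝ) * η ∈ Icc _ _ from by
        rw [h0, one_smul]
        exact ⟨by positivity, (mul_le_mul_of_nonneg_right hk hη.le).trans hD.le⟩)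
    obtain ⟨t, -, ht⟩ := this
    exact ⟨t • y, ht⟩
  choose c hc using hex
  have hclose : ∀ {k k' : Fin K} {x x' : J → ℝ}, x ∈ ball (c k) (η / 2) →
      x' ∈ ball (c k') (η / 2) → f x = f x' → k = k' := by
    intro k k' x x' hx hx' hxx
    have h1 := (hfdist x (c k)).trans_lt hx
    have h2 := (hfdist x' (c k')).trans_lt hx'
    rw [hc, hxx, abs_lt] at h1
    rw [hc, abs_lt] at h2
    have h3 : ((k : ℝ) - k') * η < 1 * η := by linarith
    have h4 : ((k' : ℝ) - k) * η < 1 * η := by linarith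
    have h5 := lt_of_mul_lt_mul_right h3 hη.le
    have h6 := lt_of_mul_lt_mul_right h4 hη.le
    have h7 : (k : ℝ) < (k' : ℕ) + 1 := by linarith
    have h8 : (k' : ℝ) < (k : ℕ) + 1 := by linarith
    norm_cast at h7 h8
    ext; omega
  set S : Set (J → ℝ) := ⋃ k : Fin K, ball (c k) (η / 2) with hS
  have hSvol : 1 < volume S := by
    rw [hS, measure_iUnion _ fun _ => measurableSet_ball]
    · simp_rw [Real.volume_pi_ball _ (half_pos hη)]
      rw [tsum_fintype, Finset.sum_const, Finset.card_univ, Fintype.card_fin, nsmul_eq_mul,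
        ← ENNReal.ofReal_natCast, ← ENNReal.ofReal_mul (by positivity), ENNReal.one_lt_ofReal,
        mul_div_cancel₀ _ two_ne_zero]
      rwa [div_lt_iff₀ (by positivity)] at hK
    · intro k k' hkk
      refine Set.disjoint_left.2 fun x hx hx' => hkk (hclose hx hx' rfl)
  have hdet' : LinearMap.det (toLin' L) = 1 := by rw [LinearMap.det_toLin', hdet]
  have hSm : MeasurableSet S := MeasurableSet.iUnion fun _ => measurableSet_ball
  have hpre : volume (toLin' L ⁻¹' S) = volume S := by
    rw [Measure.addHaar_preimage_linearMap _ (by rw [hdet']; exact one_ne_zero), hdet']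
    simp
  obtain ⟨x, hx, w, hw, hxw⟩ := exists_int_sub_mem
    (hSm.preimage (LinearMap.continuous_on_pi (toLin' L)).measurable) (hpre ▸ hSvol)
  rw [mem_preimage, toLin'_apply] at hx hxw
  rw [mulVec_add] at hxw
  obtain ⟨k, hk⟩ := mem_iUnion.1 hx
  obtain ⟨k', hk'⟩ := mem_iUnion.1 hxw
  obtain rfl := hclose hk hk' (infDist_add_latticePoints L _ w).symm
  have h1 := hL w hw
  have h2 := dist_triangle_right (L *ᵥ x + L *ᵥ fun i => (w i : ℝ)) (L *ᵥ x) (c k)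
  rw [dist_self_add_left] at h2
  rw [mem_ball] at hk hk'
  linarith

end Lattice

/-- If every point of `G` has translates by `φ Y`, `Y ∈ S`, lying in `H` with measure at least `c`,
then `H` itself has measure at least `c * μ G / μ S`. -/
lemma mul_measure_le_of_translates {E : Type*} [AddCommGroup E] [MeasurableSpace E]
    [MeasurableAdd₂ E] (μ : Measure E) [SigmaFinite μ] [μ.IsAddRightInvariant]
    {G H S : Set E} {φ : E → E} (hφ : Measurable φ) {c : ℝ≥0∞}
    (h : ∀ x ∈ G, c ≤ μ {y ∈ S | x + φ y ∈ H}) :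
    c * μ G ≤ μ S * μ H := by
  set H' := toMeasurable μ H
  have hH' : MeasurableSet H' := measurableSet_toMeasurable _ _
  set F : E → E → ℝ≥0∞ := fun x y => H'.indicator 1 (x + φ y)
  have hF : Measurable (Function.uncurry F) :=
    (measurable_one.indicator hH').comp (measurable_fst.add (hφ.comp measurable_snd))
  set f : E → ℝ≥0∞ := fun x => ∫⁻ y in S, F x y ∂μ
  have hfm : Measurable f := hF.lintegral_prod_right'
  have hGf : G ⊆ {x | c ≤ f x} := by
    intro x hx
    refine (h x hx).trans ?_
    have hm : MeasurableSet {y | x + φ y ∈ H'} := (measurable_const.add hφ) hH'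
    have : f x = μ ({y | x + φ y ∈ H'} ∩ S) := by
      rw [← Measure.restrict_apply hm, ← lintegral_indicator_one hm]
      rfl
    rw [this]
    exact measure_mono fun y hy => ⟨subset_toMeasurable _ _ hy.2, hy.1⟩
  calc c * μ G ≤ c * μ {x | c ≤ f x} := by gcongr
    _ ≤ ∫⁻ x, f x ∂μ := mul_meas_ge_le_lintegral hfm c
    _ = ∫⁻ y in S, ∫⁻ x, F x y ∂μ ∂μ := lintegral_lintegral_swap hF.aemeasurable
    _ = ∫⁻ _ in S, μ H ∂μ := by
      refine lintegral_congr fun y => ?_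
      have : ∫⁻ x, F x y ∂μ = ∫⁻ x, H'.indicator 1 x ∂μ :=
        lintegral_add_right_eq_self (H'.indicator 1) (φ y)
      rw [this, lintegral_indicator_one hH', measure_toMeasurable]
    _ = μ S * μ H := by rw [setLIntegral_const, mul_comm]

section Shear

variable {ι κ : Type*} [Fintype ι] [Fintype κ] [DecidableEq ι] [DecidableEq κ]

instance isAddHaarMeasure_volume_pi_pi :
    (volume : Measure (ι → κ → ℝ)).IsAddHaarMeasure :=
  Measure.pi.isAddHaarMeasure (fun _ : ι => (volume : Measure (κ → ℝ)))

/-- The unipotent matrix acting by `(x, z) ↦ (x + X z, z)`. -/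
def shear (X : ι → κ → ℝ) : Matrix (ι ⊕ κ) (ι ⊕ κ) ℝ := fromBlocks 1 (of X) 0 1

/-- The diagonal matrix expanding by `a` on the first block and contracting by `b` on the second. -/
noncomputable def dil (a : ι → ℝ) (b : κ → ℝ) : Matrix (ι ⊕ κ) (ι ⊕ κ) ℝ :=
  Matrix.diagonal (Sum.elim a b⁻¹)

/-- The rescaling of `Y` induced by conjugating `shear Y` with `dil a b`. -/
noncomputable def rescale (a : ι → ℝ) (b : κ → ℝ) (Y : ι → κ → ℝ) : ι → κ → ℝ :=
  fun j r => Y j r / (a j * b r)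

lemma shear_mulVec_inl (X : ι → κ → ℝ) (y : ι ⊕ κ → ℝ) (j : ι) :
    (shear X *ᵥ y) (Sum.inl j) = y (Sum.inl j) + ∑ r, X j r * y (Sum.inr r) := by
  rw [shear, fromBlocks_mulVec, Sum.elim_inl, one_mulVec]
  rfl

lemma shear_mulVec_inr (X : ι → κ → ℝ) (y : ι ⊕ κ → ℝ) (r : κ) :
    (shear X *ᵥ y) (Sum.inr r) = y (Sum.inr r) := by
  simp [shear, fromBlocks_mulVec]

lemma dil_mulVec_inl (a : ι → ℝ) (b : κ → ℝ) (y : ι ⊕ κ → ℝ) (j : ι) :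
    (dil a b *ᵥ y) (Sum.inl j) = a j * y (Sum.inl j) := by
  simp [dil, mulVec_diagonal]

lemma dil_mulVec_inr (a : ι → ℝ) (b : κ → ℝ) (y : ι ⊕ κ → ℝ) (r : κ) :
    (dil a b *ᵥ y) (Sum.inr r) = (b r)⁻¹ * y (Sum.inr r) := by
  simp [dil, mulVec_diagonal]

lemma shear_add (X Y : ι → κ → ℝ) : shear (X + Y) = shear X * shear Y := by
  simp [shear, fromBlocks_multiply, ← of_add_of, add_comm]

lemma shear_zero : shear (0 : ι → κ → ℝ) = 1 := by
  have : of (0 : ι → κ → ℝ) = (0 : Matrix ι κ ℝ) := rfl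
  simp [shear, this]

lemma dil_mul_dil (a a' : ι → ℝ) (b b' : κ → ℝ) :
    dil a b * dil a' b' = dil (a * a') (b * b') := by
  rw [dil, dil, dil, diagonal_mul_diagonal]
  congr 1
  ext (j | r) <;> simp [mul_comm]

lemma dil_one : dil (1 : ι → ℝ) (1 : κ → ℝ) = 1 := by
  rw [dil, inv_one, Sum.elim_one_one]
  exact diagonal_one

lemma dil_mul_shear_rescale {a : ι → ℝ} {b : κ → ℝ} (ha : ∀ j, 0 < a j) (hb : ∀ r, 0 < b r)
    (Y : ι → κ → ℝ) : dil a b * shear (rescale a b Y) = shear Y * dil a b := by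
  have : Matrix.diagonal a * of (rescale a b Y) = of Y * Matrix.diagonal b⁻¹ := by
    ext j r
    have := (ha j).ne'
    have := (hb r).ne'
    simp [diagonal_mul, mul_diagonal, rescale]
    field_simp
  rw [dil, shear, shear, ← fromBlocks_diagonal]
  simp [fromBlocks_multiply, this, -fromBlocks_diagonal]

lemma dil_mul_shear_add {a a' : ι → ℝ} {b b' : κ → ℝ} (ha : ∀ j, 0 < a' j) (hb : ∀ r, 0 < b' r)
    (X Y : ι → κ → ℝ) (L : Matrix (ι ⊕ κ) (ι ⊕ κ) ℝ) :
    dil (a * a') (b * b') * shear (X + rescale a' b' Y) * L =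
      dil a b * shear Y * (dil a' b' * shear X * L) := by
  rw [← dil_mul_dil, add_comm, shear_add]
  simp only [Matrix.mul_assoc]
  rw [← Matrix.mul_assoc (shear Y), ← dil_mul_shear_rescale ha hb]
  simp only [Matrix.mul_assoc]

lemma det_shear (X : ι → κ → ℝ) : (shear X).det = 1 := by
  simp [shear]

lemma det_dil {a : ι → ℝ} {b : κ → ℝ} (hb : ∀ r, 0 < b r) (h : ∏ j, a j = ∏ r, b r) :
    (dil a b).det = 1 := by
  have : ∏ r, b r ≠ 0 := (Finset.prod_pos fun r _ => hb r).ne'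
  simp [dil, h, this]

lemma norm_shear_mulVec_le (Y : ι → κ → ℝ) (y : ι ⊕ κ → ℝ) :
    ‖shear Y *ᵥ y‖ ≤ (1 + Fintype.card κ * ‖Y‖) * ‖y‖ := by
  refine (pi_norm_le_iff_of_nonneg (by positivity)).2 ?_
  rintro (j | r)
  · rw [shear_mulVec_inl, add_mul, one_mul]
    refine (norm_add_le _ _).trans (add_le_add (norm_le_pi_norm _ _) ?_)
    refine (norm_sum_le _ _).trans ?_
    calc ∑ r, ‖Y j r * y (Sum.inr r)‖ ≤ ∑ _r : κ, ‖Y‖ * ‖y‖ := by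
          refine Finset.sum_le_sum fun r _ => ?_
          rw [norm_mul]
          exact mul_le_mul ((norm_le_pi_norm (Y j) r).trans (norm_le_pi_norm Y j))
            (norm_le_pi_norm _ _) (norm_nonneg _) (norm_nonneg _)
      _ = _ := by rw [Finset.sum_const, Finset.card_univ, nsmul_eq_mul, mul_assoc]
  · rw [shear_mulVec_inr]
    refine (norm_le_pi_norm _ _).trans (le_mul_of_one_le_left (norm_nonneg _) ?_)
    have : 0 ≤ Fintype.card κ * ‖Y‖ := by positivity
    linarith

lemma SystoleGE.shear_mul {η τ : ℝ} {L : Matrix (ι ⊕ κ) (ι ⊕ κ) ℝ} (hL : SystoleGE η L)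
    {Y : ι → κ → ℝ} (hY : ‖Y‖ ≤ τ) :
    SystoleGE (η / (1 + Fintype.card κ * τ)) (shear Y * L) := by
  intro w hw
  have hτ : 0 ≤ τ := (norm_nonneg _).trans hY
  have h1 := norm_shear_mulVec_le (-Y) (shear Y *ᵥ (L *ᵥ fun i => (w i : ℝ)))
  rw [mulVec_mulVec, ← shear_add, neg_add_cancel, shear_zero, one_mulVec, norm_neg] at h1
  rw [← mulVec_mulVec, div_le_iff₀ (by positivity), mul_comm]
  refine ((hL w hw).trans h1).trans ?_
  gcongr

lemma SystoleGE.dil_mul {η t : ℝ} {L : Matrix (ι ⊕ κ) (ι ⊕ κ) ℝ} (hL : SystoleGE η L)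
    {a : ι → ℝ} {b : κ → ℝ} (ha : ∀ j, 1 ≤ a j) (hb : ∀ r, 0 < b r) (hbt : ∀ r, b r ≤ t)
    (ht : 1 ≤ t) : SystoleGE (η / t) (dil a b * L) := by
  intro w hw
  rw [← mulVec_mulVec, div_le_iff₀ (by positivity), mul_comm]
  refine (hL w hw).trans ((pi_norm_le_iff_of_nonneg (by positivity)).2 ?_)
  set y := L *ᵥ fun i => (w i : ℝ)
  rintro (j | r)
  · have h := norm_le_pi_norm (dil a b *ᵥ y) (Sum.inl j)
    rw [dil_mulVec_inl, norm_mul, Real.norm_of_nonneg (by linarith [ha j])] at h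
    have h2 := le_mul_of_one_le_left (norm_nonneg (y (Sum.inl j))) (ha j)
    exact (h2.trans h).trans (le_mul_of_one_le_left (norm_nonneg _) ht)
  · have h := norm_le_pi_norm (dil a b *ᵥ y) (Sum.inr r)
    rw [dil_mulVec_inr, norm_mul, Real.norm_of_nonneg (inv_nonneg.2 (hb r).le),
      inv_mul_le_iff₀ (hb r)] at h
    exact h.trans (mul_le_mul_of_nonneg_right (hbt r) (norm_nonneg _))

lemma norm_rescale_le {a : ι → ℝ} {b : κ → ℝ} {t : ℝ} (ht : 1 ≤ t) (ha : ∀ j, t ≤ a j)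
    (hb : ∀ r, t ≤ b r) (Y : ι → κ → ℝ) : ‖rescale a b Y‖ ≤ ‖Y‖ / t := by
  refine (pi_norm_le_iff_of_nonneg (by positivity)).2 fun j =>
    (pi_norm_le_iff_of_nonneg (by positivity)).2 fun r => ?_
  have h1 : t ≤ a j * b r := (le_mul_of_one_le_left (by linarith) (ht.trans (ha j))).trans
    (mul_le_mul_of_nonneg_left (hb r) (by linarith [ha j]))
  rw [rescale, norm_div, Real.norm_of_nonneg (by linarith : 0 ≤ a j * b r)]
  exact div_le_div₀ (norm_nonneg _) ((norm_le_pi_norm (Y j) r).trans (norm_le_pi_norm Y j))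
    (by linarith) h1

lemma measurable_rescale (a : ι → ℝ) (b : κ → ℝ) : Measurable (rescale a b) :=
  measurable_pi_lambda _ fun j => measurable_pi_lambda _ fun r =>
    ((measurable_pi_apply r).comp (measurable_pi_apply j)).div_const _

lemma volume_closedBall_pi_pi (X : ι → κ → ℝ) {σ : ℝ} (hσ : 0 ≤ σ) :
    volume (closedBall X σ) =
      ENNReal.ofReal (((2 * σ) ^ Fintype.card κ) ^ Fintype.card ι) := by
  rw [closedBall_pi _ hσ, volume_pi_pi]
  simp_rw [Real.volume_pi_closedBall _ hσ]
  rw [Finset.prod_const, Finset.card_univ, ENNReal.ofReal_pow (pow_nonneg (by positivity) _)]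

end Shear

section Nondivergence

variable {ι κ : Type*} [Fintype ι] [Fintype κ] [DecidableEq ι] [DecidableEq κ]

/-- Volume of the part of a cube lying in the slab `|c + ⟨y, z⟩| < δ`. -/
lemma volume_slab_le (z : κ → ℝ) (hz : 0 < ‖z‖) {σ : ℝ} (hσ : 0 < σ) (c : ℝ) {δ : ℝ}
    (hδ : 0 < δ) :
    volume {y ∈ closedBall (0 : κ → ℝ) σ | |c + ∑ r, y r * z r| < δ} ≤
      ENNReal.ofReal ((2 * σ) ^ Fintype.card κ * (δ / (σ * ‖z‖))) := by
  have : Nonempty κ := by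
    by_contra h
    rw [not_nonempty_iff] at h
    simp [Subsingleton.elim z 0] at hz
  obtain ⟨r, hr⟩ : ∃ r, ‖z r‖ = ‖z‖ := by
    obtain ⟨r, hr⟩ := Finite.exists_max fun r => ‖z r‖
    exact ⟨r, (norm_le_pi_norm z r).antisymm ((pi_norm_le_iff_of_nonneg (norm_nonneg _)).2 hr)⟩
  set M : Matrix κ κ ℝ := updateRow 1 r z
  have hdet : M.det = z r := by
    have h := det_updateRow_sum (1 : Matrix κ κ ℝ) r z
    have hz' : (∑ k, z k • (1 : Matrix κ κ ℝ) k) = z := by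
      ext k; simp [Finset.sum_apply, Matrix.one_apply]
    rwa [hz', det_one, smul_eq_mul, mul_one] at h
  have hzr : z r ≠ 0 := norm_pos_iff.1 (hr ▸ hz)
  have hdet' : LinearMap.det (toLin' M) = z r := by rw [LinearMap.det_toLin', hdet]
  set B : κ → Set ℝ := fun k => if k = r then Ioo (-c - δ) (-c + δ) else Icc (-σ) σ
  have hsub : {y ∈ closedBall (0 : κ → ℝ) σ | |c + ∑ r, y r * z r| < δ} ⊆
      toLin' M ⁻¹' (univ.pi B) := by
    rintro y ⟨hy, hyz⟩
    rw [mem_preimage, toLin'_apply, mem_univ_pi]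
    intro k
    by_cases hk : k = r
    · subst hk
      have : (M *ᵥ y) k = ∑ r, y r * z r := by
        simp [M, mulVec, dotProduct, mul_comm]
      simp only [B, if_true, this]
      rw [abs_lt] at hyz
      constructor <;> linarith
    · have : (M *ᵥ y) k = y k := by
        simp [M, mulVec, dotProduct, updateRow_ne hk, Matrix.one_apply]
      simp only [B, if_neg hk, this]
      rw [mem_closedBall_zero_iff] at hy
      exact abs_le.1 ((norm_le_pi_norm y k).trans hy)
  refine (measure_mono hsub).trans ?_
  rw [Measure.addHaar_preimage_linearMap _ (by rwa [hdet']), hdet', volume_pi_pi]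
  have hB : ∀ k, volume (B k) = ENNReal.ofReal (if k = r then 2 * δ else 2 * σ) := by
    intro k
    by_cases hk : k = r
    · simp only [B, if_pos hk, Real.volume_Ioo]; congr 1; ring
    · simp only [B, if_neg hk, Real.volume_Icc]; congr 1; ring
  simp_rw [hB]
  rw [← ENNReal.ofReal_prod_of_nonneg fun k _ => by split_ifs <;> positivity,
    ← ENNReal.ofReal_mul (abs_nonneg _)]
  refine ENNReal.ofReal_le_ofReal (le_of_eq ?_)
  rw [Finset.prod_ite, Finset.prod_const, Finset.prod_const, Finset.filter_eq',
    if_pos (Finset.mem_univ r), Finset.card_singleton, Finset.filter_ne',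
    Finset.card_erase_of_mem (Finset.mem_univ r), Finset.card_univ, abs_inv, ← Real.norm_eq_abs, hr]
  obtain ⟨N, hN⟩ := Nat.exists_eq_succ_of_ne_zero (Fintype.card_ne_zero (α := κ))
  rw [hN, Nat.succ_sub_one, Nat.succ_eq_add_one]
  field_simp
  ring

lemma volume_slabs_le (x : ι → ℝ) (z : κ → ℝ) (hz : 0 < ‖z‖) {σ : ℝ} (hσ : 0 < σ)
    {δ : ι → ℝ} (hδ : ∀ j, 0 < δ j) :
    volume {X ∈ closedBall (0 : ι → κ → ℝ) σ | ∀ j, |x j + ∑ r, X j r * z r| < δ j} ≤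
      ENNReal.ofReal (∏ j, ((2 * σ) ^ Fintype.card κ * (δ j / (σ * ‖z‖)))) := by
  have : {X ∈ closedBall (0 : ι → κ → ℝ) σ | ∀ j, |x j + ∑ r, X j r * z r| < δ j} =
      univ.pi fun j => {y ∈ closedBall (0 : κ → ℝ) σ | |x j + ∑ r, y r * z r| < δ j} := by
    ext X
    rw [closedBall_pi _ hσ.le]
    simp only [mem_univ_pi, mem_ofPred_eq, forall_and]
    rfl
  rw [this, volume_pi_pi, ENNReal.ofReal_prod_of_nonneg]
  · exact Finset.prod_le_prod' fun j _ => volume_slab_le z hz hσ (x j) (hδ j)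
  · intro j _
    have := hδ j
    positivity

/-- Integer vectors with prescribed bounds on the absolute values of the coordinates. -/
noncomputable def intBox {γ : Type*} [Fintype γ] [DecidableEq γ] (R : γ → ℝ) : Finset (γ → ℤ) :=
  Fintype.piFinset fun i => Finset.Icc (-⌊R i⌋) ⌊R i⌋

lemma mem_intBox {γ : Type*} [Fintype γ] [DecidableEq γ] {R : γ → ℝ} {e : γ → ℤ}
    (h : ∀ i, |(e i : ℝ)| ≤ R i) : e ∈ intBox R := by
  refine Fintype.mem_piFinset.2 fun i => Finset.mem_Icc.2 ?_
  rw [← abs_le, Int.le_floor]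
  exact_mod_cast h i

lemma card_intBox_le {γ : Type*} [Fintype γ] [DecidableEq γ] {R : γ → ℝ} (hR : ∀ i, 0 ≤ R i) :
    ((intBox R).card : ℝ) ≤ ∏ i, (2 * R i + 1) := by
  rw [intBox, Fintype.card_piFinset]
  push_cast
  refine Finset.prod_le_prod (fun _ _ => by positivity) fun i _ => ?_
  rw [Int.card_Icc]
  have h0 : 0 ≤ ⌊R i⌋ := Int.floor_nonneg.2 (hR i)
  have h1 : (((⌊R i⌋ + 1 - -⌊R i⌋).toNat : ℤ) : ℝ) = 2 * ⌊R i⌋ + 1 := by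
    rw [Int.toNat_of_nonneg (by omega)]
    push_cast; ring
  have h2 := Int.floor_le (R i)
  rw [Int.cast_natCast] at h1
  rw [h1]
  linarith

lemma SystoleGE.eq_of_floor_eq {J : Type*} [Fintype J] [Nonempty J] {η : ℝ} (hη : 0 < η)
    {L : Matrix J J ℝ}
    (hL : SystoleGE η L) {w w' : J → ℤ}
    (h : ∀ i, ⌊(L *ᵥ fun k => (w k : ℝ)) i / η⌋ = ⌊(L *ᵥ fun k => (w' k : ℝ)) i / η⌋) : w = w' := by
  by_contra hne
  have h1 := hL (w - w') (sub_ne_zero.2 hne)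
  have : (fun i => (((w - w') i : ℤ) : ℝ)) = (fun i => (w i : ℝ)) - fun i => (w' i : ℝ) := by
    ext; simp
  rw [this, mulVec_sub] at h1
  refine absurd h1 (not_le.2 ((pi_norm_lt_iff hη).2 fun i => ?_))
  have h2 := Int.abs_sub_lt_one_of_floor_eq_floor (h i)
  rwa [← sub_div, abs_div, abs_of_pos hη, div_lt_one hη] at h2

/-- Quantitative constraints on a lattice vector that becomes short. -/
lemma SystoleGE.bounds_of_short {η η' σ : ℝ} (hη : 0 < η) (hη' : 0 < η') (hηη' : η' ≤ η / 2)
    (hσ : 0 < σ) {L : Matrix (ι ⊕ κ) (ι ⊕ κ) ℝ} (hL : SystoleGE η L) {a : ι → ℝ} {b : κ → ℝ}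
    (ha : ∀ j, 1 ≤ a j) (hb : ∀ r, 0 < b r) {X : ι → κ → ℝ} (hX : X ∈ closedBall 0 σ)
    {w : ι ⊕ κ → ℤ} (hw : w ≠ 0) {y : ι ⊕ κ → ℝ} (hy : y = L *ᵥ fun i => (w i : ℝ))
    (hshort : ‖(dil a b * shear X) *ᵥ y‖ < η') :
    (∀ j, |y (.inl j) + ∑ r, X j r * y (.inr r)| < η' / a j) ∧
    (∀ r, |y (.inr r)| < η' * b r) ∧
    (∀ j, |y (.inl j)| ≤ η / 2 + Fintype.card κ * σ * ‖fun r => y (.inr r)‖) ∧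
    η / (2 * (Fintype.card κ * σ + 1)) ≤ ‖fun r => y (.inr r)‖ := by
  set z : κ → ℝ := fun r => y (.inr r)
  rw [← mulVec_mulVec, pi_norm_lt_iff hη'] at hshort
  have h1 : ∀ j, |y (.inl j) + ∑ r, X j r * y (.inr r)| < η' / a j := fun j => by
    have h := hshort (.inl j)
    have haj : 0 < a j := by linarith [ha j]
    rwa [dil_mulVec_inl, shear_mulVec_inl, norm_mul, Real.norm_of_nonneg haj.le,
      ← lt_div_iff₀' haj] at h
  have h2 : ∀ r, |y (.inr r)| < η' * b r := fun r => by
    have h := hshort (.inr r)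
    rwa [dil_mulVec_inr, shear_mulVec_inr, norm_mul,
      Real.norm_of_nonneg (inv_nonneg.2 (hb r).le), inv_mul_lt_iff₀ (hb r), mul_comm (b r)] at h
  have h3 : ∀ j, |y (.inl j)| ≤ η / 2 + Fintype.card κ * σ * ‖z‖ := fun j => by
    have haj : 0 < a j := by linarith [ha j]
    have h4 : |∑ r, X j r * y (.inr r)| ≤ Fintype.card κ * σ * ‖z‖ := by
      refine (Finset.abs_sum_le_sum_abs _ _).trans ?_
      calc ∑ r, |X j r * y (.inr r)| ≤ ∑ _r : κ, σ * ‖z‖ := by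
            refine Finset.sum_le_sum fun r _ => ?_
            rw [abs_mul]
            rw [mem_closedBall_zero_iff] at hX
            exact mul_le_mul (((norm_le_pi_norm (X j) r).trans (norm_le_pi_norm X j)).trans hX)
              (norm_le_pi_norm z r) (abs_nonneg _) hσ.le
        _ = _ := by rw [Finset.sum_const, Finset.card_univ, nsmul_eq_mul, mul_assoc]
    have h5 : η' / a j ≤ η / 2 := (div_le_self hη'.le (ha j)).trans hηη'
    have h6 := abs_sub_abs_le_abs_sub (y (.inl j)) (-∑ r, X j r * y (.inr r))
    rw [sub_neg_eq_add, abs_neg] at h6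
    linarith [h1 j]
  refine ⟨h1, h2, h3, ?_⟩
  have h7 : η ≤ η / 2 + (Fintype.card κ * σ + 1) * ‖z‖ := by
    refine (hL w hw).trans ((pi_norm_le_iff_of_nonneg (by positivity)).2 ?_)
    rw [← hy]
    rintro (j | r)
    · refine (h3 j).trans ?_
      rw [add_mul]
      linarith [norm_nonneg z]
    · refine (norm_le_pi_norm z r).trans ?_
      have : 0 ≤ Fintype.card κ * σ * ‖z‖ := by positivity
      rw [add_mul]
      linarith
  rw [div_le_iff₀ (by positivity)]
  linarith

/-- For a lattice with shortest vector at least `η`, the expanded translates `dil a b * shear X * L`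
have no very short vectors, outside a set of `X` of small measure. -/
lemma SystoleGE.volume_not_systoleGE_le (ι κ : Type*) [Fintype ι] [Fintype κ] [DecidableEq ι]
    [DecidableEq κ] [Nonempty κ] {η σ δ : ℝ} (hη : 0 < η) (hσ : 0 < σ) (hδ : 0 < δ) :
    ∃ η' > 0, ∃ T ≥ 1, ∀ L : Matrix (ι ⊕ κ) (ι ⊕ κ) ℝ, SystoleGE η L →
      ∀ (a : ι → ℝ) (b : κ → ℝ), (∀ j, T ≤ a j) → (∀ r, T ≤ b r) → ∏ j, a j = ∏ r, b r →
        volume {X ∈ closedBall (0 : ι → κ → ℝ) σ | ¬ SystoleGE η' (dil a b * shear X * L)} ≤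
          ENNReal.ofReal δ := by
  set n : ℝ := (Fintype.card κ : ℝ) with hn
  set ζ : ℝ := η / (2 * (n * σ + 1)) with hζ
  have hζ0 : 0 < ζ := by positivity
  set θ : ℝ := 1 / η + 2 / ζ with hθ
  have hθ0 : 0 < θ := by positivity
  set R : ℝ := n * σ + 2 with hR
  have hR0 : 0 < R := by positivity
  set C : ℝ := (5 / η) ^ Fintype.card κ *
    ((2 * R + 1) * ((2 * σ) ^ Fintype.card κ * (θ / σ))) ^ Fintype.card ι with hC
  have hC0 : 0 < C := by positivity
  set η' : ℝ := min 1 (min (η / 2) (δ / C))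
  have hη'0 : 0 < η' := by positivity
  have hη'1 : η' ≤ 1 := min_le_left _ _
  have hη'2 : η' ≤ η / 2 := (min_le_right _ _).trans (min_le_left _ _)
  have hη'3 : η' * C ≤ δ := by
    rw [← le_div_iff₀ hC0]; exact (min_le_right _ _).trans (min_le_right _ _)
  refine ⟨η', hη'0, max 1 (η / η'), le_max_left _ _, fun L hL a b ha hb hab => ?_⟩
  have ha1 : ∀ j, 1 ≤ a j := fun j => (le_max_left _ _).trans (ha j)
  have hb1 : ∀ r, 1 ≤ b r := fun r => (le_max_left _ _).trans (hb r)
  have ha0 : ∀ j, 0 < a j := fun j => one_pos.trans_le (ha1 j)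
  have hb0 : ∀ r, 0 < b r := fun r => one_pos.trans_le (hb1 r)
  have hbη : ∀ r, 1 ≤ η' * b r / η := fun r => by
    have := (le_max_right _ _).trans (hb r)
    rw [div_le_iff₀ hη'0] at this
    rw [le_div_iff₀ hη]
    linarith
  set vec : (ι ⊕ κ → ℤ) → ι ⊕ κ → ℝ := fun w => L *ᵥ fun i => (w i : ℝ)
  set U : (ι → ℤ) → (κ → ℤ) → Set (ι → κ → ℝ) := fun e f =>
    {X ∈ closedBall (0 : ι → κ → ℝ) σ | ∃ w, w ≠ 0 ∧ (∀ j, ⌊vec w (.inl j) / η⌋ = e j) ∧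
      (∀ r, ⌊vec w (.inr r) / η⌋ = f r) ∧ ‖(dil a b * shear X) *ᵥ vec w‖ < η'}
  have hfloor : ∀ t : ℝ, |(⌊t / η⌋ : ℝ)| ≤ |t| / η + 1 := fun t => by
    have h1 := Int.floor_le (t / η)
    have h2 := Int.lt_floor_add_one (t / η)
    rw [← abs_of_pos hη, ← abs_div, abs_of_pos hη]
    have h3 := neg_abs_le (t / η)
    have h4 := le_abs_self (t / η)
    rw [abs_le]
    constructor <;> linarith
  -- size of the second component in terms of its cell
  have hcell : ∀ (w : ι ⊕ κ → ℤ) (f : κ → ℤ), (∀ r, ⌊vec w (.inr r) / η⌋ = f r) →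
      ‖fun r => vec w (.inr r)‖ ≤ η * (‖f‖ + 1) ∧
        ‖f‖ ≤ ‖fun r => vec w (.inr r)‖ / η + 1 := by
    intro w f hf
    constructor
    · refine (pi_norm_le_iff_of_nonneg (by positivity)).2 fun r => ?_
      have h1 := Int.floor_le (vec w (.inr r) / η)
      have h2 := Int.lt_floor_add_one (vec w (.inr r) / η)
      have h3 : |(f r : ℝ)| ≤ ‖f‖ := by
        rw [← Int.norm_eq_abs]; exact norm_le_pi_norm f r
      rw [hf] at h1 h2
      rw [abs_le] at h3
      rw [mul_comm, ← div_le_iff₀ hη, Real.norm_eq_abs,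
        show |vec w (.inr r)| / η = |vec w (.inr r) / η| by rw [abs_div, abs_of_pos hη], abs_le]
      constructor <;> linarith
    · refine (pi_norm_le_iff_of_nonneg (by positivity)).2 fun r => ?_
      rw [Int.norm_eq_abs, ← hf r]
      refine (hfloor _).trans ?_
      gcongr
      exact norm_le_pi_norm (fun r => vec w (.inr r)) r
  have hUvol : ∀ e f, volume (U e f) ≤ ENNReal.ofReal
      (∏ j, ((2 * σ) ^ Fintype.card κ * (η' / a j * θ / (σ * (‖f‖ + 1))))) := by
    intro e f
    rcases (U e f).eq_empty_or_nonempty with h | ⟨X₀, hX₀, w₀, hw₀, he₀, hf₀, hs₀⟩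
    · rw [h, measure_empty]; exact zero_le
    obtain ⟨-, -, -, hz⟩ := hL.bounds_of_short hη hη'0 hη'2 hσ ha1 hb0 hX₀ hw₀ rfl hs₀
    rw [← hn, ← hζ] at hz
    set z : κ → ℝ := fun r => vec w₀ (.inr r)
    have hz0 : 0 < ‖z‖ := hζ0.trans_le hz
    have hfz : ‖f‖ + 1 ≤ ‖z‖ * θ := by
      have h1 := (hcell w₀ f hf₀).2
      have h2 : 2 ≤ ‖z‖ * (2 / ζ) := by
        rw [← mul_div_assoc, le_div_iff₀ hζ0]; linarith
      rw [hθ, mul_add, mul_one_div]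
      linarith
    refine (measure_mono ?_).trans ((volume_slabs_le (fun j => vec w₀ (.inl j)) z hz0 hσ
      (δ := fun j => η' / a j) fun j => div_pos hη'0 (ha0 j)).trans
        (ENNReal.ofReal_le_ofReal (Finset.prod_le_prod (fun j _ => ?_) fun j _ => ?_)))
    · rintro X ⟨hX, w, hw, he, hf, hs⟩
      have hww : w = w₀ := by
        refine hL.eq_of_floor_eq hη ?_
        rintro (j | r)
        · exact (he j).trans (he₀ j).symm
        · exact (hf r).trans (hf₀ r).symm
      subst hww
      exact ⟨hX, (hL.bounds_of_short hη hη'0 hη'2 hσ ha1 hb0 hX hw rfl hs).1⟩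
    · have := ha0 j
      positivity
    · have := ha0 j
      gcongr ?_ * ?_
      rw [div_le_div_iff₀ (by positivity) (by positivity)]
      have h5 : η' / a j * σ * (‖f‖ + 1) ≤ η' / a j * σ * (‖z‖ * θ) := by gcongr
      linarith
  set P : Finset (κ → ℤ) := intBox fun r => 2 * (η' * b r / η)
  set E : (κ → ℤ) → Finset (ι → ℤ) := fun f => intBox fun _ => R * (‖f‖ + 1)
  have hcover : {X ∈ closedBall (0 : ι → κ → ℝ) σ |
      ¬ SystoleGE η' (dil a b * shear X * L)} ⊆ ⋃ f ∈ P, ⋃ e ∈ E f, U e f := by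
    rintro X ⟨hX, hns⟩
    rw [SystoleGE] at hns
    push Not at hns
    obtain ⟨w, hw, hs⟩ := hns
    rw [← mulVec_mulVec] at hs
    obtain ⟨-, h2, h3, -⟩ := hL.bounds_of_short hη hη'0 hη'2 hσ ha1 hb0 hX hw rfl hs
    set f : κ → ℤ := fun r => ⌊vec w (.inr r) / η⌋ with hf
    set e : ι → ℤ := fun j => ⌊vec w (.inl j) / η⌋ with he
    have hfP : f ∈ P := mem_intBox fun r => by
      refine (hfloor _).trans ?_
      have : |vec w (.inr r)| / η ≤ η' * b r / η := by
        gcongr; exact (h2 r).le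
      linarith [hbη r]
    have heE : e ∈ E f := mem_intBox fun j => by
      refine (hfloor _).trans ?_
      have h4 := (hcell w f fun _ => rfl).1
      have h5 : |vec w (.inl j)| / η ≤ 1 / 2 + n * σ * (‖f‖ + 1) := by
        rw [div_le_iff₀ hη]
        refine (h3 j).trans ?_
        have : n * σ * ‖fun r => vec w (.inr r)‖ ≤ n * σ * (η * (‖f‖ + 1)) := by gcongr
        rw [← hn]
        linarith
      rw [hR]
      nlinarith [norm_nonneg f]
    simp only [mem_iUnion]
    exact ⟨f, hfP, e, heE, hX, w, hw, fun _ => rfl, fun _ => rfl, hs⟩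
  set D : ℝ := ∏ j, ((2 * R + 1) * ((2 * σ) ^ Fintype.card κ * (η' / a j * θ / σ))) with hD
  have hD0 : 0 ≤ D := Finset.prod_nonneg fun j _ => by have := ha0 j; positivity
  have hsum : ∀ f, volume (⋃ e ∈ E f, U e f) ≤ ENNReal.ofReal D := by
    intro f
    refine (measure_biUnion_finset_le _ _).trans ((Finset.sum_le_sum fun e _ => hUvol e f).trans ?_)
    rw [Finset.sum_const, nsmul_eq_mul, ← ENNReal.ofReal_natCast,
      ← ENNReal.ofReal_mul (by positivity)]
    refine ENNReal.ofReal_le_ofReal ?_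
    refine (mul_le_mul_of_nonneg_right (card_intBox_le fun _ => by positivity)
      (Finset.prod_nonneg fun j _ => by have := ha0 j; positivity)).trans ?_
    rw [← Finset.prod_mul_distrib]
    refine Finset.prod_le_prod (fun j _ => by have := ha0 j; positivity) fun j _ => ?_
    have := ha0 j
    have hle : 2 * (R * (‖f‖ + 1)) + 1 ≤ (2 * R + 1) * (‖f‖ + 1) := by
      nlinarith [norm_nonneg f]
    refine (mul_le_mul_of_nonneg_right hle (by positivity)).trans (le_of_eq ?_)
    field_simp
  refine (measure_mono hcover).trans ((measure_biUnion_finset_le _ _).trans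
    ((Finset.sum_le_sum fun f _ => hsum f).trans ?_))
  rw [Finset.sum_const, nsmul_eq_mul, ← ENNReal.ofReal_natCast,
    ← ENNReal.ofReal_mul (by positivity)]
  refine ENNReal.ofReal_le_ofReal ?_
  have hPcard : (P.card : ℝ) ≤ ∏ r, (5 / η * η' * b r) := by
    refine (card_intBox_le fun r => by linarith [hbη r]).trans
      (Finset.prod_le_prod (fun r _ => by linarith [hbη r]) fun r _ => ?_)
    have h1 : 5 / η * η' * b r = 5 * (η' * b r / η) := by field_simp
    rw [h1]
    linarith [hbη r]
  refine (mul_le_mul_of_nonneg_right hPcard hD0).trans ?_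
  have hprod : ∏ r, b r ≠ 0 := (Finset.prod_pos fun r _ => hb0 r).ne'
  have h1 : ∏ r, (5 / η * η' * b r) =
      (5 / η) ^ Fintype.card κ * η' ^ Fintype.card κ * ∏ r, b r := by
    rw [Finset.prod_mul_distrib, Finset.prod_const, Finset.card_univ, mul_pow]
  have h2 : D = ((2 * R + 1) * ((2 * σ) ^ Fintype.card κ * (θ / σ))) ^ Fintype.card ι *
      η' ^ Fintype.card ι * (∏ r, b r)⁻¹ := by
    rw [← hab, ← Finset.prod_inv_distrib, ← mul_pow, ← Finset.card_univ (α := ι),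
      ← Finset.prod_const, ← Finset.prod_mul_distrib, hD]
    refine Finset.prod_congr rfl fun j _ => ?_
    have := (ha0 j).ne'
    field_simp
  rw [h1, h2]
  calc _ = η' ^ (Fintype.card κ + Fintype.card ι) * C := by
        rw [hC, pow_add]; field_simp
    _ ≤ η' ^ 1 * C := by
        refine mul_le_mul_of_nonneg_right (pow_le_pow_of_le_one hη'0.le hη'1 ?_) hC0.le
        have := Fintype.card_pos (α := κ)
        omega
    _ ≤ δ := by rwa [pow_one]

end Nondivergence

section Hitting

/-- The lattice `M ℤ^J` has a vector of norm at most `ε` whose coordinates are congruent to `v`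
modulo `N`. -/
def HitsClass {J : Type*} [Fintype J] (N : ℕ) (v : J → ℤ) (ε : ℝ) (M : Matrix J J ℝ) : Prop :=
  ∃ w : J → ℤ, (∀ i, w i ≡ v i [ZMOD N]) ∧ ‖M *ᵥ fun i => (w i : ℝ)‖ ≤ ε

lemma exists_modEq_covering (J : Type*) [Fintype J] [DecidableEq J] {η : ℝ} (hη : 0 < η) {N : ℕ}
    (hN : 0 < N) :
    ∃ ρ > 0, ∀ L : Matrix J J ℝ, L.det = 1 → SystoleGE η L → ∀ (v : J → ℤ) (y : J → ℝ),
      ∃ w : J → ℤ, (∀ i, w i ≡ v i [ZMOD N]) ∧ ‖y - L *ᵥ fun i => (w i : ℝ)‖ ≤ ρ := by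
  obtain ⟨ρ, hρ, h⟩ := SystoleGE.exists_covering J hη
  have hN' : (0 : ℝ) < N := Nat.cast_pos.2 hN
  refine ⟨N * ρ, by positivity, fun L hdet hL v y => ?_⟩
  obtain ⟨u, hu⟩ := h L hdet hL ((N : ℝ)⁻¹ • (y - L *ᵥ fun i => (v i : ℝ)))
  refine ⟨v + (N : ℤ) • u, fun i => ?_, ?_⟩
  · simp [Int.ModEq]
  · have h1 : y - (L *ᵥ fun i => (((v + (N : ℤ) • u) i : ℤ) : ℝ)) =
        (N : ℝ) • ((N : ℝ)⁻¹ • (y - L *ᵥ fun i => (v i : ℝ)) - L *ᵥ fun i => (u i : ℝ)) := by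
      have : (fun i => (((v + (N : ℤ) • u) i : ℤ) : ℝ)) =
          (fun i => (v i : ℝ)) + (N : ℝ) • fun i => (u i : ℝ) := by ext; simp
      rw [this, mulVec_add, mulVec_smul, smul_sub, smul_inv_smul₀ hN'.ne']
      abel
    rw [h1, norm_smul, Real.norm_of_nonneg hN'.le]
    gcongr

/-- A lattice with systole bounded below has translates hitting a given congruence class near the
origin, for a cube of shears of size bounded below. -/
lemma SystoleGE.exists_hitsClass (ι κ : Type*) [Fintype ι] [Fintype κ] [DecidableEq ι]
    [DecidableEq κ] [Nonempty ι] [Nonempty κ] {η ε : ℝ} (hη : 0 < η) (hε : 0 < ε) {N : ℕ}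
    (hN : 0 < N) :
    ∃ t ≥ 1, ∃ s > 0, s ≤ 1 / 2 ∧ ∀ L : Matrix (ι ⊕ κ) (ι ⊕ κ) ℝ, L.det = 1 → SystoleGE η L →
      ∀ v, ∃ Y₀ : ι → κ → ℝ, ‖Y₀‖ ≤ 1 / 2 ∧ ∀ Y ∈ closedBall Y₀ s,
        HitsClass N v ε
          (dil (fun _ => t ^ Fintype.card κ) (fun _ => t ^ Fintype.card ι) * shear Y * L) := by
  obtain ⟨ρ, hρ, h⟩ := exists_modEq_covering (ι ⊕ κ) hη hN
  set t := max 1 (4 * ρ / ε)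
  have ht1 : 1 ≤ t := le_max_left _ _
  have ht0 : 0 < t := one_pos.trans_le ht1
  have htε : 4 * ρ ≤ t * ε := (div_le_iff₀ hε).1 (le_max_right _ _)
  have hcard : (0 : ℝ) < Fintype.card κ := Nat.cast_pos.2 Fintype.card_pos
  set s := min (1 / 2) (ε / (t ^ Fintype.card κ * (Fintype.card κ * (4 * ρ))))
  have hs0 : 0 < s := by positivity
  refine ⟨t, ht1, s, hs0, min_le_left _ _, fun L hdet hL v => ?_⟩
  obtain ⟨r₀⟩ := ‹Nonempty κ›
  obtain ⟨w, hwv, hw⟩ := h L hdet hL v (Sum.elim 0 (Pi.single r₀ (3 * ρ)))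
  set p := L *ᵥ fun i => (w i : ℝ)
  have hx : ∀ j, |p (.inl j)| ≤ ρ := fun j => by
    simpa using (norm_le_pi_norm _ (Sum.inl j)).trans hw
  have hz₀ : 2 * ρ ≤ p (.inr r₀) := by
    have := abs_le.1 ((norm_le_pi_norm _ (Sum.inr r₀)).trans hw)
    simp at this
    linarith
  have hz : ∀ r, |p (.inr r)| ≤ 4 * ρ := fun r => by
    have := abs_le.1 ((norm_le_pi_norm _ (Sum.inr r)).trans hw)
    rw [abs_le]
    by_cases hr : r = r₀
    · subst hr
      simp at this
      constructor <;> linarith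
    · simp [hr] at this
      constructor <;> linarith
  have hz0 : 0 < p (.inr r₀) := by linarith
  set Y₀ : ι → κ → ℝ := fun j => Pi.single r₀ (-p (.inl j) / p (.inr r₀)) with hY₀
  refine ⟨Y₀, ?_, fun Y hY => ⟨w, hwv, ?_⟩⟩
  · refine (pi_norm_le_iff_of_nonneg (by norm_num)).2 fun j => ?_
    rw [hY₀, Pi.norm_single, norm_div, norm_neg, Real.norm_of_nonneg hz0.le, div_le_iff₀ hz0,
      Real.norm_eq_abs]
    linarith [hx j]
  · rw [← mulVec_mulVec, ← mulVec_mulVec]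
    refine (pi_norm_le_iff_of_nonneg hε.le).2 ?_
    rintro (j | r)
    · rw [dil_mulVec_inl, shear_mulVec_inl]
      have h0 : p (.inl j) + ∑ r, Y₀ j r * p (.inr r) = 0 := by
        simp only [hY₀, Pi.single_apply, ite_mul, zero_mul, Finset.sum_ite_eq', Finset.mem_univ,
          if_true]
        field_simp
        ring
      have h1 : p (.inl j) + ∑ r, Y j r * p (.inr r) = ∑ r, (Y j r - Y₀ j r) * p (.inr r) := by
        simp only [sub_mul, Finset.sum_sub_distrib]
        linarith
      have h2 : ‖∑ r, (Y j r - Y₀ j r) * p (.inr r)‖ ≤ Fintype.card κ * (s * (4 * ρ)) := by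
        refine (norm_sum_le _ _).trans ?_
        rw [← nsmul_eq_mul, ← Finset.card_univ, ← Finset.sum_const]
        refine Finset.sum_le_sum fun r _ => ?_
        rw [norm_mul]
        rw [mem_closedBall, dist_eq_norm] at hY
        exact mul_le_mul (((norm_le_pi_norm ((Y - Y₀) j) r).trans (norm_le_pi_norm _ j)).trans hY)
          (hz r) (norm_nonneg _) hs0.le
      have h3 : s * (t ^ Fintype.card κ * (Fintype.card κ * (4 * ρ))) ≤ ε :=
        (le_div_iff₀ (by positivity)).1 (min_le_right _ _)
      rw [h1, norm_mul, Real.norm_of_nonneg (by positivity)]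
      calc _ ≤ t ^ Fintype.card κ * (Fintype.card κ * (s * (4 * ρ))) := by gcongr
        _ ≤ ε := by linarith
    · rw [dil_mulVec_inr, shear_mulVec_inr, norm_mul, Real.norm_of_nonneg (by positivity),
        inv_mul_le_iff₀ (by positivity)]
      calc ‖p (.inr r)‖ ≤ t * ε := (hz r).trans htε
        _ ≤ t ^ Fintype.card ι * ε := by
          gcongr
          exact le_self_pow₀ ht1 Fintype.card_ne_zero

end Hitting

section Chain

/-- Under a large expansion, a positive proportion of shears brings the lattice back to a lattice
with systole bounded below that has a short vector in a given congruence class. -/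
lemma SystoleGE.volume_hitsClass_ge (ι κ : Type*) [Fintype ι] [Fintype κ] [DecidableEq ι]
    [DecidableEq κ] [Nonempty ι] [Nonempty κ] {η σ ε : ℝ} (hη : 0 < η) (hσ : 0 < σ) (hε : 0 < ε)
    {N : ℕ} (hN : 0 < N) :
    ∃ c : ℝ≥0∞, c ≠ 0 ∧ ∃ η' > 0, ∃ T ≥ 1, ∀ L : Matrix (ι ⊕ κ) (ι ⊕ κ) ℝ, L.det = 1 →
      SystoleGE η L → ∀ (a : ι → ℝ) (b : κ → ℝ), (∀ j, T ≤ a j) → (∀ r, T ≤ b r) →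
        ∏ j, a j = ∏ r, b r → ∀ v,
          c ≤ volume {X ∈ closedBall (0 : ι → κ → ℝ) σ |
            SystoleGE η' (dil a b * shear X * L) ∧ HitsClass N v ε (dil a b * shear X * L)} := by
  set V : ℝ := ((2 * (σ / 2)) ^ Fintype.card κ) ^ Fintype.card ι
  have hV : 0 < V := by positivity
  obtain ⟨η₁, hη₁, T₁, hT₁, hND⟩ := SystoleGE.volume_not_systoleGE_le ι κ hη (half_pos hσ)
    (half_pos hV)
  obtain ⟨t, ht, s, hs, hs2, hhit⟩ := SystoleGE.exists_hitsClass ι κ hη₁ hε hN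
  have ht0 : 0 < t := one_pos.trans_le ht
  set c₀ := volume (closedBall (0 : ι → κ → ℝ) s)
  set S : Set (ι → κ → ℝ) := closedBall 0 1
  have hS : volume S ≠ ⊤ := isCompact_closedBall (0 : ι → κ → ℝ) 1 |>.measure_ne_top
  have hc₀ : c₀ ≠ 0 := (measure_closedBall_pos _ _ hs).ne'
  set T₂ := max T₁ (2 / σ)
  have hT₂ : 1 ≤ T₂ := hT₁.trans (le_max_left _ _)
  set τ := t ^ (Fintype.card κ + Fintype.card ι)
  have hτ1 : t ^ Fintype.card κ ≤ τ := pow_le_pow_right₀ ht (Nat.le_add_right _ _)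
  have hτ2 : t ^ Fintype.card ι ≤ τ := pow_le_pow_right₀ ht (Nat.le_add_left _ _)
  refine ⟨c₀ * ENNReal.ofReal (V / 2) / volume S, ?_, η₁ / (1 + Fintype.card κ * 1) /
    t ^ Fintype.card ι, by positivity, T₂ * τ, ?_, fun L hdet hL a b ha hb hab v => ?_⟩
  · refine (ENNReal.div_pos (mul_ne_zero hc₀ ?_) hS).ne'
    exact (ENNReal.ofReal_pos.2 (half_pos hV)).ne'
  · exact one_le_mul_of_one_le_of_one_le hT₂ (one_le_pow₀ ht)
  set a₁ : ι → ℝ := fun j => a j / t ^ Fintype.card κ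
  set b₁ : κ → ℝ := fun r => b r / t ^ Fintype.card ι
  have ha₁ : ∀ j, T₂ ≤ a₁ j := fun j => by
    rw [le_div_iff₀ (by positivity)]
    exact (mul_le_mul_of_nonneg_left hτ1 (by linarith)).trans (ha j)
  have hb₁ : ∀ r, T₂ ≤ b₁ r := fun r => by
    rw [le_div_iff₀ (by positivity)]
    exact (mul_le_mul_of_nonneg_left hτ2 (by linarith)).trans (hb r)
  have hab₁ : ∏ j, a₁ j = ∏ r, b₁ r := by
    simp only [a₁, b₁, Finset.prod_div_distrib, hab, Finset.prod_const, Finset.card_univ,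
      ← pow_mul, mul_comm]
  have ha₁0 : ∀ j, 0 < a₁ j := fun j => by linarith [ha₁ j]
  have hb₁0 : ∀ r, 0 < b₁ r := fun r => by linarith [hb₁ r]
  have haa : a = (fun _ => t ^ Fintype.card κ) * a₁ := by
    ext j; simp only [a₁, Pi.mul_apply]; field_simp
  have hbb : b = (fun _ => t ^ Fintype.card ι) * b₁ := by
    ext j; simp only [b₁, Pi.mul_apply]; field_simp
  set G : Set (ι → κ → ℝ) :=
    {X ∈ closedBall (0 : ι → κ → ℝ) (σ / 2) | SystoleGE η₁ (dil a₁ b₁ * shear X * L)}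
  have hG : ENNReal.ofReal (V / 2) ≤ volume G := by
    have h1 : volume (closedBall (0 : ι → κ → ℝ) (σ / 2)) ≤ volume G + ENNReal.ofReal (V / 2) := by
      refine (measure_mono (t := G ∪ {X ∈ closedBall (0 : ι → κ → ℝ) (σ / 2) |
        ¬ SystoleGE η₁ (dil a₁ b₁ * shear X * L)}) fun X hX => ?_).trans
        ((measure_union_le _ _).trans (add_le_add le_rfl (hND L hL a₁ b₁
          (fun j => (le_max_left _ _).trans (ha₁ j)) (fun r => (le_max_left _ _).trans (hb₁ r))
          hab₁)))
      by_cases h : SystoleGE η₁ (dil a₁ b₁ * shear X * L)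
      · exact Or.inl ⟨hX, h⟩
      · exact Or.inr ⟨hX, h⟩
    rw [volume_closedBall_pi_pi _ (half_pos hσ).le, ← add_halves (((2 * (σ / 2)) ^ _) ^ _),
      ENNReal.ofReal_add (half_pos hV).le (half_pos hV).le] at h1
    exact ENNReal.le_of_add_le_add_right ENNReal.ofReal_ne_top h1
  refine ENNReal.div_le_of_le_mul' ?_
  refine (mul_le_mul_right hG c₀).trans ?_
  refine mul_measure_le_of_translates volume (measurable_rescale a₁ b₁) fun X hX => ?_
  obtain ⟨hXσ, hXs⟩ := hX
  have hdet₁ : (dil a₁ b₁ * shear X * L).det = 1 := by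
    rw [det_mul, det_mul, det_dil hb₁0 hab₁, det_shear, hdet, one_mul, one_mul]
  obtain ⟨Y₀, hY₀, hY⟩ := hhit _ hdet₁ hXs v
  have hc : c₀ = volume (closedBall Y₀ s) := by
    rw [volume_closedBall_pi_pi _ hs.le, ← volume_closedBall_pi_pi 0 hs.le]
  rw [hc]
  refine measure_mono fun Y hYm => ?_
  have hY1 : ‖Y‖ ≤ 1 := by
    have h1 := norm_le_norm_add_norm_sub' Y Y₀
    rw [mem_closedBall, dist_eq_norm] at hYm
    linarith
  refine ⟨mem_closedBall_zero_iff.2 hY1, ?_, ?_⟩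
  · rw [mem_closedBall_zero_iff] at hXσ ⊢
    have h1 := norm_rescale_le hT₂ ha₁ hb₁ Y
    have h2 : ‖Y‖ / T₂ ≤ σ / 2 := by
      rw [div_le_iff₀ (by linarith)]
      have : σ / 2 * (2 / σ) ≤ σ / 2 * T₂ := by gcongr; exact le_max_right _ _
      have h3 : σ / 2 * (2 / σ) = 1 := by field_simp
      linarith
    linarith [norm_add_le X (rescale a₁ b₁ Y)]
  · rw [haa, hbb, dil_mul_shear_add ha₁0 hb₁0]
    refine ⟨?_, hY Y hYm⟩
    rw [Matrix.mul_assoc]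
    exact (hXs.shear_mul hY1).dil_mul (fun _ => one_le_pow₀ ht) (fun _ => by positivity)
      (fun _ => le_rfl) (one_le_pow₀ ht)

lemma SystoleGE.volume_chain_hitsClass_ge (ι κ : Type*) [Fintype ι] [Fintype κ] [DecidableEq ι]
    [DecidableEq κ] [Nonempty ι] [Nonempty κ] {ε : ℝ} (hε : 0 < ε) {N : ℕ} (hN : 0 < N) (k : ℕ) :
    ∀ {η σ : ℝ}, 0 < η → 0 < σ → ∃ c : ℝ≥0∞, c ≠ 0 ∧ ∃ T ≥ (1 : ℝ),
      ∀ L : Matrix (ι ⊕ κ) (ι ⊕ κ) ℝ, L.det = 1 → SystoleGE η L →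
        ∀ (A : ℕ → ι → ℝ) (B : ℕ → κ → ℝ), A 0 = 1 → B 0 = 1 →
          (∀ i j, 0 < A i j) → (∀ i r, 0 < B i r) →
          (∀ i < k, ∀ j, T * A i j ≤ A (i + 1) j) → (∀ i < k, ∀ r, T * B i r ≤ B (i + 1) r) →
          (∀ i, ∏ j, A i j = ∏ r, B i r) → ∀ v : ℕ → ι ⊕ κ → ℤ,
            c ≤ volume {X ∈ closedBall (0 : ι → κ → ℝ) σ | ∀ i < k,
              HitsClass N (v i) ε (dil (A (i + 1)) (B (i + 1)) * shear X * L)} := by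
  induction k with
  | zero =>
    intro η σ _ hσ
    refine ⟨volume (closedBall (0 : ι → κ → ℝ) σ), (measure_closedBall_pos _ _ hσ).ne', 1, le_rfl,
      fun L _ _ A B _ _ _ _ _ _ _ v => measure_mono fun X hX => ⟨hX, by simp⟩⟩
  | succ k ih =>
    intro η σ hη hσ
    obtain ⟨c₁, hc₁, η₁, hη₁, T₁, hT₁, h₁⟩ :=
      SystoleGE.volume_hitsClass_ge ι κ hη (half_pos hσ) (half_pos hε) hN
    set σ' : ℝ := 1 / (Fintype.card κ + 1)
    have hσ' : 0 < σ' := by positivity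
    have hσ'1 : σ' ≤ 1 := by
      rw [div_le_one (by positivity)]
      linarith [(Nat.cast_nonneg (Fintype.card κ) : (0 : ℝ) ≤ _)]
    have hσ'2 : 1 + Fintype.card κ * σ' ≤ 2 := by
      have : Fintype.card κ * σ' ≤ 1 := by
        rw [mul_one_div, div_le_one (by positivity)]
        linarith
      linarith
    obtain ⟨c₂, hc₂, T₂, hT₂, h₂⟩ := ih hη₁ hσ'
    set S : Set (ι → κ → ℝ) := closedBall 0 σ'
    have hS : volume S ≠ ⊤ := isCompact_closedBall (0 : ι → κ → ℝ) σ' |>.measure_ne_top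
    set T := max T₁ (max T₂ (2 / σ))
    have hTT₁ : T₁ ≤ T := le_max_left _ _
    have hTT₂ : T₂ ≤ T := (le_max_left _ _).trans (le_max_right _ _)
    have hT1 : 1 ≤ T := hT₁.trans hTT₁
    refine ⟨c₂ * c₁ / volume S, (ENNReal.div_pos (mul_ne_zero hc₂ hc₁) hS).ne', T, hT1,
      fun L hdet hL A B hA0 hB0 hA hB hAT hBT hAB v => ?_⟩
    have hA1 : ∀ j, T ≤ A 1 j := fun j => by simpa [hA0] using hAT 0 k.succ_pos j
    have hB1 : ∀ r, T ≤ B 1 r := fun r => by simpa [hB0] using hBT 0 k.succ_pos r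
    refine ENNReal.div_le_of_le_mul' ?_
    refine (mul_le_mul_right (h₁ L hdet hL (A 1) (B 1) (fun j => hTT₁.trans (hA1 j))
      (fun r => hTT₁.trans (hB1 r)) (hAB 1) (v 0)) c₂).trans ?_
    refine mul_measure_le_of_translates volume (measurable_rescale (A 1) (B 1))
      fun X ⟨hXσ, hXs, w, hwv, hw⟩ => ?_
    have hdet₁ : (dil (A 1) (B 1) * shear X * L).det = 1 := by
      rw [det_mul, det_mul, det_dil (hB 1) (hAB 1), det_shear, hdet, one_mul, one_mul]
    refine (h₂ _ hdet₁ hXs (fun i => A (i + 1) / A 1) (fun i => B (i + 1) / B 1) ?_ ?_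
      (fun i j => div_pos (hA _ j) (hA 1 j)) (fun i r => div_pos (hB _ r) (hB 1 r)) ?_ ?_ ?_
      fun i => v (i + 1)).trans (measure_mono fun Y hY => ⟨hY.1, ?_, fun i hi => ?_⟩)
    · ext j; exact div_self (hA 1 j).ne'
    · ext r; exact div_self (hB 1 r).ne'
    · intro i hi j
      rw [Pi.div_apply, Pi.div_apply, ← mul_div_assoc, div_le_div_iff_of_pos_right (hA 1 j)]
      exact (mul_le_mul_of_nonneg_right hTT₂ (hA _ j).le).trans (hAT (i + 1) (by omega) j)
    · intro i hi r
      rw [Pi.div_apply, Pi.div_apply, ← mul_div_assoc, div_le_div_iff_of_pos_right (hB 1 r)]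
      exact (mul_le_mul_of_nonneg_right hTT₂ (hB _ r).le).trans (hBT (i + 1) (by omega) r)
    · intro i
      simp only [Pi.div_apply, Finset.prod_div_distrib, hAB]
    · have h3 := mem_closedBall_zero_iff.1 hY.1
      rw [mem_closedBall_zero_iff] at hXσ ⊢
      have h1 := norm_rescale_le hT1 hA1 hB1 Y
      have h2 : ‖Y‖ / T ≤ σ / 2 := by
        rw [div_le_iff₀ (by linarith)]
        have : σ / 2 * (2 / σ) ≤ σ / 2 * T := by
          gcongr; exact (le_max_right _ _).trans (le_max_right _ _)
        have h3 : σ / 2 * (2 / σ) = 1 := by field_simp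
        linarith
      linarith [norm_add_le X (rescale (A 1) (B 1) Y)]
    · rcases i with _ | i
      · refine ⟨w, hwv, ?_⟩
        have h4 := dil_mul_shear_add (a := 1) (b := 1) (hA 1) (hB 1) X Y L
        rw [one_mul, one_mul, dil_one, Matrix.one_mul] at h4
        rw [zero_add, h4, ← mulVec_mulVec]
        have h3 := mem_closedBall_zero_iff.1 hY.1
        calc _ ≤ (1 + Fintype.card κ * ‖Y‖) * (ε / 2) :=
              (norm_shear_mulVec_le _ _).trans (by gcongr)
          _ ≤ 2 * (ε / 2) := by
              gcongr
              refine le_trans ?_ hσ'2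
              gcongr
          _ = ε := by ring
      · have h4 := hY.2 i (by omega)
        rw [← dil_mul_shear_add (hA 1) (hB 1)] at h4
        have hA' : A (i + 1 + 1) / A 1 * A 1 = A (i + 1 + 1) := by
          ext j; exact div_mul_cancel₀ _ (hA 1 j).ne'
        have hB' : B (i + 1 + 1) / B 1 * B 1 = B (i + 1 + 1) := by
          ext r; exact div_mul_cancel₀ _ (hB 1 r).ne'
        rwa [hA', hB'] at h4

end Chain

section Recurrence

variable {ι κ : Type*} [Fintype ι] [Fintype κ] [DecidableEq ι] [DecidableEq κ]

lemma systoleGE_one (J : Type*) [Fintype J] [DecidableEq J] :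
    SystoleGE 1 (1 : Matrix J J ℝ) := by
  intro w hw
  obtain ⟨i, hi⟩ := Function.ne_iff.1 hw
  rw [one_mulVec]
  refine le_trans ?_ (norm_le_pi_norm _ i)
  rw [Real.norm_eq_abs]
  exact_mod_cast Int.one_le_abs hi

/-- The trajectory `dil (k ^ n) (k ^ m) * shear θ` of a typical `θ` does not diverge. -/
lemma ae_frequently_systoleGE (ι κ : Type*) [Fintype ι] [Fintype κ] [DecidableEq ι]
    [DecidableEq κ] [Nonempty ι] [Nonempty κ] :
    ∀ᵐ θ : ι → κ → ℝ, ∃ η > 0, ∃ᶠ k : ℕ in atTop,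
      SystoleGE η (dil (fun _ => (k : ℝ) ^ Fintype.card κ) (fun _ => (k : ℝ) ^ Fintype.card ι) *
        shear θ) := by
  set D : ℕ → (ι → κ → ℝ) → Matrix (ι ⊕ κ) (ι ⊕ κ) ℝ := fun k θ =>
    dil (fun _ => (k : ℝ) ^ Fintype.card κ) (fun _ => (k : ℝ) ^ Fintype.card ι) * shear θ
  set B : Set (ι → κ → ℝ) := {θ | ¬ ∃ η > 0, ∃ᶠ k : ℕ in atTop, SystoleGE η (D k θ)}
  have hM : ∀ M : ℕ, volume (closedBall (0 : ι → κ → ℝ) (M + 1) ∩ B) = 0 := by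
    intro M
    refine le_antisymm (ENNReal.le_of_forall_pos_le_add fun δ hδ _ => ?_) zero_le
    obtain ⟨η, hη, T, -, h⟩ := SystoleGE.volume_not_systoleGE_le ι κ one_pos
      (by positivity : (0 : ℝ) < M + 1) (NNReal.coe_pos.2 hδ)
    rw [zero_add]
    rw [ENNReal.ofReal_coe_nnreal] at h
    obtain ⟨K₀, hK₀⟩ := exists_nat_ge (max T 1)
    set bad : ℕ → Set (ι → κ → ℝ) := fun k =>
      {X ∈ closedBall (0 : ι → κ → ℝ) (M + 1) | ¬ SystoleGE η (D k X)}
    have hbad : ∀ k ≥ K₀, volume (bad k) ≤ δ := by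
      intro k hk
      have hkT : max T 1 ≤ k := hK₀.trans (Nat.cast_le.2 hk)
      have h1 : (1 : ℝ) ≤ k := (le_max_right _ _).trans hkT
      have h2 := h 1 (systoleGE_one _) (fun _ => (k : ℝ) ^ Fintype.card κ)
        (fun _ => (k : ℝ) ^ Fintype.card ι)
        (fun _ => ((le_max_left _ _).trans hkT).trans (le_self_pow₀ h1 Fintype.card_ne_zero))
        (fun _ => ((le_max_left _ _).trans hkT).trans (le_self_pow₀ h1 Fintype.card_ne_zero))
        (by simp only [Finset.prod_const, Finset.card_univ, ← pow_mul, mul_comm])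
      simpa only [Matrix.mul_one] using h2
    have hsub : closedBall (0 : ι → κ → ℝ) (M + 1) ∩ B ⊆ ⋃ K : ℕ, ⋂ k ≥ K, bad k := by
      rintro θ ⟨hθ, hθB⟩
      have h3 : ∀ᶠ k in atTop, ¬ SystoleGE η (D k θ) :=
        not_frequently.1 fun h => hθB ⟨η, hη, h⟩
      obtain ⟨K, hK⟩ := eventually_atTop.1 h3
      exact mem_iUnion.2 ⟨K, mem_iInter₂.2 fun k hk => ⟨hθ, hK k hk⟩⟩
    refine (measure_mono hsub).trans ?_
    rw [Monotone.measure_iUnion]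
    · refine iSup_le fun K => (measure_mono ?_).trans (hbad (max K K₀) (le_max_right _ _))
      exact biInter_subset_of_mem (le_max_left K K₀)
    · exact fun K K' hK => biInter_subset_biInter_left fun k hk => le_trans hK hk
  have : B ⊆ ⋃ M : ℕ, closedBall (0 : ι → κ → ℝ) (M + 1) ∩ B := by
    intro θ hθ
    obtain ⟨M, hM⟩ := exists_nat_ge ‖θ‖
    exact mem_iUnion.2 ⟨M, mem_closedBall_zero_iff.2 (by linarith), hθ⟩
  exact measure_mono_null this (measure_iUnion_null hM)

open scoped Pointwise in
lemma volume_inter_closedBall (G : Set (ι → κ → ℝ)) (θ : ι → κ → ℝ) {r : ℝ} (hr : 0 < r) :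
    volume (G ∩ closedBall θ r) =
      ENNReal.ofReal (r ^ Module.finrank ℝ (ι → κ → ℝ)) *
        volume {X ∈ closedBall (0 : ι → κ → ℝ) 1 | θ + r • X ∈ G} := by
  have h1 : (fun X => θ + X) ⁻¹' (G ∩ closedBall θ r) =
      r • {X ∈ closedBall (0 : ι → κ → ℝ) 1 | θ + r • X ∈ G} := by
    ext X
    rw [mem_smul_set_iff_inv_smul_mem₀ hr.ne', mem_preimage, mem_inter_iff, mem_ofPred_eq,
      smul_inv_smul₀ hr.ne', mem_closedBall_zero_iff, norm_smul, norm_inv,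
      Real.norm_of_nonneg hr.le, inv_mul_le_iff₀ hr, mul_one, mem_closedBall, dist_eq_norm,
      add_sub_cancel_left, and_comm]
  rw [← measure_preimage_add volume θ, h1, Measure.addHaar_smul, abs_of_pos (by positivity)]

/-- A measurable set is conull as soon as it has positive density at the scales of recurrence of
the trajectories `dil (k ^ n) (k ^ m) * shear θ`. -/
lemma ae_mem_of_recurrence [Nonempty ι] [Nonempty κ] {G : Set (ι → κ → ℝ)} (hG : MeasurableSet G)
    (h : ∀ η > 0, ∃ c : ℝ≥0∞, c ≠ 0 ∧ ∀ k : ℕ, 0 < k → ∀ θ : ι → κ → ℝ,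
      SystoleGE η (dil (fun _ => (k : ℝ) ^ Fintype.card κ) (fun _ => (k : ℝ) ^ Fintype.card ι) *
        shear θ) →
      c ≤ volume {X ∈ closedBall (0 : ι → κ → ℝ) 1 |
        θ + rescale (fun _ => (k : ℝ) ^ Fintype.card κ) (fun _ => (k : ℝ) ^ Fintype.card ι) X ∈
          G}) :
    ∀ᵐ θ, θ ∈ G := by
  have hdens := ae_imp_of_ae_restrict
    (IsUnifLocDoublingMeasure.ae_tendsto_measure_inter_div (volume : Measure (ι → κ → ℝ)) Gᶜ 1)
  filter_upwards [ae_frequently_systoleGE ι κ, hdens] with θ ⟨η, hη, hfreq⟩ hθ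
  by_contra hθG
  obtain ⟨c, hc, hcG⟩ := h η hη
  set s : Set ℕ := {k | SystoleGE η (dil (fun _ => (k : ℝ) ^ Fintype.card κ)
    (fun _ => (k : ℝ) ^ Fintype.card ι) * shear θ)}
  have : (atTop ⊓ 𝓟 s).NeBot := frequently_mem_iff_neBot.1 hfreq
  set p := Fintype.card κ + Fintype.card ι
  have hp : p ≠ 0 := by have := Fintype.card_pos (α := κ); omega
  set δ : ℕ → ℝ := fun k => ((k : ℝ) ^ p)⁻¹
  have hδ : Tendsto δ (atTop ⊓ 𝓟 s) (𝓝[>] 0) := by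
    refine Tendsto.mono_left ?_ inf_le_left
    exact tendsto_inv_atTop_nhdsGT_zero.comp
      ((tendsto_pow_atTop hp).comp tendsto_natCast_atTop_atTop)
  have hpos : ∀ᶠ k in atTop ⊓ 𝓟 s, 0 < k :=
    (eventually_gt_atTop 0).filter_mono inf_le_left
  have hlim := hθ hθG (fun _ => θ) δ hδ (by
    filter_upwards [hpos] with k hk
    have : 0 < δ k := by positivity
    exact mem_closedBall_self (by positivity))
  set V := volume (closedBall (0 : ι → κ → ℝ) 1)
  have hV : V ≠ ⊤ := (isCompact_closedBall _ _).measure_ne_top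
  have hle : ∀ᶠ k in atTop ⊓ 𝓟 s,
      volume (Gᶜ ∩ closedBall θ (δ k)) / volume (closedBall θ (δ k)) + c / V ≤ 1 := by
    filter_upwards [hpos, mem_inf_of_right (mem_principal_self s)] with k hk hks
    have hδk : 0 < δ k := by positivity
    have h1 := hcG k hk θ hks
    have h2 : rescale (fun _ : ι => (k : ℝ) ^ Fintype.card κ)
        (fun _ : κ => (k : ℝ) ^ Fintype.card ι) = fun X => δ k • X := by
      ext X j r
      simp only [rescale, δ, p, Pi.smul_apply, smul_eq_mul, pow_add]
      rw [div_eq_inv_mul]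
    rw [h2] at h1
    set W := ENNReal.ofReal (δ k ^ Module.finrank ℝ (ι → κ → ℝ))
    have hW0 : W ≠ 0 := (ENNReal.ofReal_pos.2 (by positivity)).ne'
    have hW : W ≠ ⊤ := ENNReal.ofReal_ne_top
    have hball : volume (closedBall θ (δ k)) = W * V := by
      have := volume_inter_closedBall univ θ hδk
      simp only [univ_inter, mem_univ, and_true] at this
      exact this
    have hGb : W * c ≤ volume (G ∩ closedBall θ (δ k)) := by
      rw [volume_inter_closedBall G θ hδk]
      gcongr
    have hsum : volume (Gᶜ ∩ closedBall θ (δ k)) + W * c ≤ W * V := by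
      rw [← hball, ← measure_inter_add_sdiff (closedBall θ (δ k)) hG, add_comm]
      refine add_le_add ?_ (le_of_eq ?_)
      · rwa [inter_comm]
      · rw [sdiff_eq, inter_comm]
    rw [hball, ← ENNReal.mul_div_mul_left c V hW0 hW, ← ENNReal.add_div]
    exact ENNReal.div_le_of_le_mul (by rwa [one_mul])
  have h3 := le_of_tendsto (hlim.add_const (c / V)) hle
  have h4 : c / V ≠ 0 := (ENNReal.div_pos hc hV).ne'
  have h5 : (1 : ℝ≥0∞) < 1 + c / V := ENNReal.lt_add_right ENNReal.one_ne_top h4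
  exact absurd h3 (not_le.2 h5)

end Recurrence

section Approximation

variable {ι κ : Type*} [Fintype ι] [Fintype κ] [DecidableEq ι] [DecidableEq κ]

lemma measurableSet_hitsClass (N : ℕ) (v : ι ⊕ κ → ℤ) (ε : ℝ) (a : ι → ℝ) (b : κ → ℝ) :
    MeasurableSet {θ : ι → κ → ℝ | HitsClass N v ε (dil a b * shear θ)} := by
  have : {θ : ι → κ → ℝ | HitsClass N v ε (dil a b * shear θ)} =
      ⋃ w : ι ⊕ κ → ℤ, {θ | (∀ i, w i ≡ v i [ZMOD N]) ∧
        ‖(dil a b * shear θ) *ᵥ fun i => (w i : ℝ)‖ ≤ ε} := by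
    ext θ
    simp [HitsClass]
  rw [this]
  refine MeasurableSet.iUnion fun w => (MeasurableSet.const _).inter (IsClosed.measurableSet ?_)
  refine isClosed_le (continuous_norm.comp (continuous_pi ?_)) continuous_const
  rintro (j | r)
  · simp only [← mulVec_mulVec, dil_mulVec_inl, shear_mulVec_inl]
    fun_prop
  · simp only [← mulVec_mulVec, dil_mulVec_inr, shear_mulVec_inr]
    fun_prop

/-- Approximation in several congruence classes, in terms of flows with increasing exponents. -/
lemma ae_exists_forall_hitsClass [Nonempty ι] [Nonempty κ] {ε : ℝ} (hε : 0 < ε) {N : ℕ}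
    (hN : 0 < N) (ℓ : ℕ) (e : ℕ → ι → ℝ) (f : ℕ → κ → ℝ) (he : ∀ i j, 0 < e i j)
    (hf : ∀ i r, 0 < f i r) (hef : ∀ i, ∑ j, e i j = ∑ r, f i r)
    (he' : ∀ i, i + 1 < ℓ → ∀ j, e i j < e (i + 1) j)
    (hf' : ∀ i, i + 1 < ℓ → ∀ r, f i r < f (i + 1) r) (v : ℕ → ι ⊕ κ → ℤ) :
    ∀ᵐ θ : ι → κ → ℝ, ∀ T : ℕ, ∃ Q : ℕ, T < Q ∧ ∀ i < ℓ,
      HitsClass N (v i) ε (dil (fun j => (Q : ℝ) ^ e i j) (fun r => (Q : ℝ) ^ f i r) *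
        shear θ) := by
  rw [ae_all_iff]
  intro T₀
  refine ae_mem_of_recurrence (G := {θ | ∃ Q : ℕ, T₀ < Q ∧ ∀ i < ℓ, HitsClass N (v i) ε
    (dil (fun j => (Q : ℝ) ^ e i j) (fun r => (Q : ℝ) ^ f i r) * shear θ)}) ?_ fun η hη => ?_
  · have : {θ : ι → κ → ℝ | ∃ Q : ℕ, T₀ < Q ∧ ∀ i < ℓ, HitsClass N (v i) ε
        (dil (fun j => (Q : ℝ) ^ e i j) (fun r => (Q : ℝ) ^ f i r) * shear θ)} =
        ⋃ Q : ℕ, ⋃ _ : T₀ < Q, ⋂ i : ℕ, ⋂ _ : i < ℓ, {θ | HitsClass N (v i) ε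
          (dil (fun j => (Q : ℝ) ^ e i j) (fun r => (Q : ℝ) ^ f i r) * shear θ)} := by
      ext θ
      simp
    rw [this]
    exact MeasurableSet.iUnion fun Q => MeasurableSet.iUnion fun _ => MeasurableSet.iInter fun i =>
      MeasurableSet.iInter fun _ => measurableSet_hitsClass _ _ _ _ _
  obtain ⟨c, hc, T, hT, h⟩ := SystoleGE.volume_chain_hitsClass_ge ι κ hε hN ℓ hη one_pos
  refine ⟨c, hc, fun k hk θ hθ => ?_⟩
  set kn : ℝ := (k : ℝ) ^ Fintype.card κ
  set km : ℝ := (k : ℝ) ^ Fintype.card ι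
  have hkn : 0 < kn := by positivity
  have hkm : 0 < km := by positivity
  have hlarge : ∀ C s : ℝ, 0 < s → ∀ᶠ Q : ℕ in atTop, C ≤ (Q : ℝ) ^ s := fun C s hs =>
    ((tendsto_rpow_atTop hs).comp tendsto_natCast_atTop_atTop).eventually_ge_atTop C
  have hlarge' : ∀ x y : ℝ, x < y → ∀ᶠ Q : ℕ in atTop, T * (Q : ℝ) ^ x ≤ (Q : ℝ) ^ y := by
    intro x y hxy
    filter_upwards [hlarge T (y - x) (by linarith), eventually_gt_atTop 0] with Q hQ hQ0
    have : (0 : ℝ) < Q := by positivity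
    rw [Real.rpow_sub this] at hQ
    rwa [← le_div_iff₀ (by positivity)]
  have hstep : ∀ᶠ Q : ℕ in atTop, ∀ i ∈ Finset.range (ℓ - 1),
      (∀ j, T * (Q : ℝ) ^ e i j ≤ (Q : ℝ) ^ e (i + 1) j) ∧
        ∀ r, T * (Q : ℝ) ^ f i r ≤ (Q : ℝ) ^ f (i + 1) r := by
    rw [Filter.eventually_all_finset]
    intro i hi
    have hi' : i + 1 < ℓ := by rw [Finset.mem_range] at hi; omega
    exact (eventually_all.2 fun j => hlarge' _ _ (he' i hi' j)).and
      (eventually_all.2 fun r => hlarge' _ _ (hf' i hi' r))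
  obtain ⟨Q, ⟨hQ, hQe, hQf⟩, hQT⟩ := ((hstep.and ((eventually_all.2 fun j =>
    hlarge (T * kn) _ (he 0 j)).and (eventually_all.2 fun r =>
    hlarge (T * km) _ (hf 0 r)))).and (eventually_gt_atTop T₀)).exists
  have hQ0 : (0 : ℝ) < Q := Nat.cast_pos.2 (by omega)
  set A : ℕ → ι → ℝ := fun i => Nat.casesOn i 1 fun i j => (Q : ℝ) ^ e i j / kn
  set B : ℕ → κ → ℝ := fun i => Nat.casesOn i 1 fun i r => (Q : ℝ) ^ f i r / km
  have hprod : ∏ _j : ι, kn = ∏ _r : κ, km := by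
    simp only [kn, km, Finset.prod_const, Finset.card_univ, ← pow_mul, mul_comm]
  refine (h _ ?_ hθ A B rfl rfl ?_ ?_ ?_ ?_ ?_ v).trans (measure_mono fun X hX =>
    ⟨hX.1, Q, hQT, fun i hi => ?_⟩)
  · rw [det_mul, det_dil (fun _ => hkm) hprod, det_shear, one_mul]
  · rintro (_ | i) j
    · exact one_pos
    · exact div_pos (Real.rpow_pos_of_pos hQ0 _) hkn
  · rintro (_ | i) r
    · exact one_pos
    · exact div_pos (Real.rpow_pos_of_pos hQ0 _) hkm
  · rintro (_ | i) hi j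
    · change T * 1 ≤ _ / kn
      rw [mul_one, le_div_iff₀ hkn]
      exact hQe j
    · change T * (_ / kn) ≤ _ / kn
      rw [← mul_div_assoc, div_le_div_iff_of_pos_right hkn]
      exact (hQ i (Finset.mem_range.2 (by omega))).1 j
  · rintro (_ | i) hi r
    · change T * 1 ≤ _ / km
      rw [mul_one, le_div_iff₀ hkm]
      exact hQf r
    · change T * (_ / km) ≤ _ / km
      rw [← mul_div_assoc, div_le_div_iff_of_pos_right hkm]
      exact (hQ i (Finset.mem_range.2 (by omega))).2 r
  · rintro (_ | i)
    · simp [A, B]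
    · simp only [A, B, Finset.prod_div_distrib, hprod]
      rw [← Real.rpow_sum_of_pos hQ0, ← Real.rpow_sum_of_pos hQ0, hef]
  · have h1 := hX.2 i hi
    have h2 := dil_mul_shear_add (a := A (i + 1)) (b := B (i + 1)) (a' := fun _ => kn)
      (b' := fun _ => km) (fun _ => hkn) (fun _ => hkm) θ X 1
    have hA : A (i + 1) * (fun _ => kn) = fun j => (Q : ℝ) ^ e i j := by
      ext j; exact div_mul_cancel₀ _ hkn.ne'
    have hB : B (i + 1) * (fun _ => km) = fun r => (Q : ℝ) ^ f i r := by
      ext r; exact div_mul_cancel₀ _ hkm.ne'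
    rw [Matrix.mul_one, Matrix.mul_one, hA, hB] at h2
    rwa [← h2] at h1

lemma quasiNorm_le_mul_rpow {k : ℕ} [Nonempty (Fin k)] {α x : Fin k → ℝ} {Q κ ε : ℝ}
    (hα : ∀ j, 0 < α j) (hα' : ∑ j, α j = 1) (hQ : 0 < Q) (hε : 0 < ε)
    (h : ∀ j, |x j| ≤ min ε 1 * Q ^ (κ * α j)) : quasiNorm α x ≤ ε * Q ^ κ := by
  refine ciSup_le fun j => ?_
  have hα1 : α j ≤ 1 := hα' ▸ Finset.single_le_sum (fun i _ => (hα i).le) (Finset.mem_univ j)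
  have hmin : 0 < min ε 1 := lt_min hε one_pos
  calc |x j| ^ (1 / α j) ≤ (min ε 1 * Q ^ (κ * α j)) ^ (1 / α j) :=
        Real.rpow_le_rpow (abs_nonneg _) (h j) (one_div_nonneg.2 (hα j).le)
    _ = min ε 1 ^ (1 / α j) * Q ^ κ := by
        rw [Real.mul_rpow hmin.le (Real.rpow_nonneg hQ.le _), ← Real.rpow_mul hQ.le, mul_assoc,
          mul_one_div_cancel (hα j).ne', mul_one]
    _ ≤ ε * Q ^ κ := by
        gcongr
        refine (Real.rpow_le_rpow_of_exponent_ge hmin (min_le_right _ _)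
          ((one_le_div (hα j)).2 hα1)).trans ?_
        rw [Real.rpow_one]
        exact min_le_left _ _

end Approximation

end

/-- Weighted simultaneous Diophantine approximation in several congruence
classes (Theorem B of the paper).  Given `ε > 0`, congruence data `N i`, `v i`,
weights `α i` (dimension `m`) and `β i` (dimension `n`) for `1 ≤ i ≤ ℓ`, and
positive reals `κ i` with `κ i • (α i, β i) - κ (i-1) • (α (i-1), β (i-1))`
coordinatewise positive for `2 ≤ i ≤ ℓ`, for Lebesgue-almost every real
`m × n` matrix `θ` there are arbitrarily large `Q ∈ ℝ` such that for each
`1 ≤ i ≤ ℓ` some `(p i, q i) ∈ ℤ^m × ℤ^n` satisfies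
`‖θ q i + p i‖_{α i} ≤ ε Q ^ (-κ i)`, `‖q i‖_{β i} ≤ ε Q ^ (κ i)` and the
prescribed congruences mod `N i`. -/
theorem weighted_congruence_approx (m n : ℕ) (hm : 0 < m) (hn : 0 < n)
    (ε : ℝ) (hε : 0 < ε) (ℓ : ℕ) (hℓ : 0 < ℓ)
    (N : ℕ → Fin (m + n) → ℕ) (hN : ∀ i j, 0 < N i j) (v : ℕ → Fin (m + n) → ℤ)
    (α : ℕ → Fin m → ℝ) (β : ℕ → Fin n → ℝ)
    (hα : ∀ i, (∀ j, 0 < α i j) ∧ ∑ j, α i j = 1)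
    (hβ : ∀ i, (∀ j, 0 < β i j) ∧ ∑ j, β i j = 1)
    (κ : ℕ → ℝ) (hκ : ∀ i, 0 < κ i)
    (hsep : ∀ i, 2 ≤ i → i ≤ ℓ →
      (∀ j : Fin m, κ (i - 1) * α (i - 1) j < κ i * α i j) ∧
      (∀ j : Fin n, κ (i - 1) * β (i - 1) j < κ i * β i j)) :
    ∀ᵐ θ : Fin m → Fin n → ℝ, ∀ T : ℝ, ∃ Q : ℝ, T < Q ∧
      ∀ i, 1 ≤ i → i ≤ ℓ → ∃ p : Fin m → ℤ, ∃ q : Fin n → ℤ,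
        quasiNorm (α i) (fun j => ∑ r, θ j r * (q r : ℝ) + (p j : ℝ)) ≤ ε * Q ^ (-(κ i)) ∧
        quasiNorm (β i) (fun r => (q r : ℝ)) ≤ ε * Q ^ (κ i) ∧
        (∀ j : Fin m, p j ≡ v i (Fin.castAdd n j) [ZMOD (N i (Fin.castAdd n j))]) ∧
        (∀ r : Fin n, q r ≡ v i (Fin.natAdd m r) [ZMOD (N i (Fin.natAdd m r))]) := by
  have : Nonempty (Fin m) := ⟨⟨0, hm⟩⟩
  have : Nonempty (Fin n) := ⟨⟨0, hn⟩⟩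
  set M := ∏ i ∈ Finset.Icc 1 ℓ, ∏ j, N i j
  have hM : 0 < M := Finset.prod_pos fun i _ => Finset.prod_pos fun j _ => hN i j
  have hNM : ∀ i, 1 ≤ i → i ≤ ℓ → ∀ j, N i j ∣ M := fun i h1 h2 j =>
    (Finset.dvd_prod_of_mem _ (Finset.mem_univ j)).trans
      (Finset.dvd_prod_of_mem (fun i => ∏ j, N i j) (Finset.mem_Icc.2 ⟨h1, h2⟩))
  have hmain := ae_exists_forall_hitsClass (ε := min ε 1) (lt_min hε one_pos) hM ℓ
    (fun i j => κ (i + 1) * α (i + 1) j) (fun i r => κ (i + 1) * β (i + 1) r)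
    (fun i j => mul_pos (hκ _) ((hα _).1 j)) (fun i r => mul_pos (hκ _) ((hβ _).1 r))
    (fun i => by rw [← Finset.mul_sum, ← Finset.mul_sum, (hα _).2, (hβ _).2])
    (fun i hi => (hsep (i + 2) (by omega) (by omega)).1)
    (fun i hi => (hsep (i + 2) (by omega) (by omega)).2)
    (fun i => Sum.elim (fun j => v (i + 1) (Fin.castAdd n j)) fun r => v (i + 1) (Fin.natAdd m r))
  filter_upwards [hmain] with θ hθ T
  obtain ⟨T₀, hT₀⟩ := exists_nat_ge T
  obtain ⟨Q, hTQ, hQ⟩ := hθ T₀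
  have hQ0 : (0 : ℝ) < Q := Nat.cast_pos.2 (by omega)
  refine ⟨Q, hT₀.trans_lt (Nat.cast_lt.2 hTQ), fun i hi1 hiℓ => ?_⟩
  obtain ⟨i, rfl⟩ := Nat.exists_eq_add_of_le' hi1
  obtain ⟨w, hwv, hw⟩ := hQ i (by omega)
  rw [← Matrix.mulVec_mulVec] at hw
  refine ⟨fun j => w (.inl j), fun r => w (.inr r), ?_, ?_, fun j => ?_, fun r => ?_⟩
  · refine quasiNorm_le_mul_rpow (hα _).1 (hα _).2 hQ0 hε fun j => ?_
    have h := (norm_le_pi_norm _ (Sum.inl j)).trans hw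
    rw [dil_mulVec_inl, shear_mulVec_inl, norm_mul, Real.norm_of_nonneg (by positivity),
      ← le_div_iff₀' (by positivity), add_comm] at h
    rwa [neg_mul, Real.rpow_neg hQ0.le, ← div_eq_mul_inv]
  · refine quasiNorm_le_mul_rpow (hβ _).1 (hβ _).2 hQ0 hε fun r => ?_
    have h := (norm_le_pi_norm _ (Sum.inr r)).trans hw
    rwa [dil_mulVec_inr, shear_mulVec_inr, norm_mul, Real.norm_of_nonneg (by positivity),
      inv_mul_le_iff₀ (by positivity), mul_comm] at h
  · exact (hwv (.inl j)).of_dvd (Int.natCast_dvd_natCast.2 (hNM _ hi1 hiℓ _))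
  · exact (hwv (.inr r)).of_dvd (Int.natCast_dvd_natCast.2 (hNM _ hi1 hiℓ _))
end

section
/- Suppose 0 < ε < 1, γ ∈ SL_d(ℤ), g ∈ SL_d(ℝ), N is a positive integer, and α, β are weights of dimensions m and n respectively. If there exists γ̃ ∈ Γ_N such that gγγ̃ ∈ K·A_ε·U, then there exists a primitive vector w ∈ ℤ^d with w ≡ γe_1 (mod N) such that ‖gw‖_{α,β} < ε. -/
open Matrix

/-- The first standard basis vector `e₁ = (1,0,…,0)` of `ℤ^d`. -/
def stdE1 (d : ℕ) : Fin d → ℤ := fun i => if (i : ℕ) = 0 then 1 else 0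

theorem stdE1_eq_single {d : ℕ} (h : 0 < d) :
    stdE1 d = Pi.single (⟨0, h⟩ : Fin d) (1 : ℤ) := by
  funext i
  simp [stdE1, Pi.single_apply, Fin.ext_iff]

/-- A column of an integer matrix of determinant one is a primitive vector. -/
theorem gcd_col_eq_one_of_det_eq_one {ι : Type*} [Fintype ι] [DecidableEq ι]
    {M : Matrix ι ι ℤ} (hM : M.det = 1) (j : ι) : Finset.univ.gcd (M.col j) = 1 := by
  have hinv : M.adjugate * M = 1 := by rw [adjugate_mul, hM, one_smul]
  have hdvd : Finset.univ.gcd (M.col j) ∣ 1 := by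
    have hjj : ∑ i, M.adjugate j i * M i j = 1 := by
      simpa [mul_apply] using congrFun (congrFun hinv j) j
    rw [← hjj]
    exact Finset.dvd_sum fun i hi => (Finset.gcd_dvd hi).mul_left _
  rw [← Finset.normalize_gcd]
  exact normalize_eq_one.mpr (isUnit_of_dvd_one hdvd)

/-- The entries of a real orthogonal matrix are bounded by one in absolute value. -/
theorem abs_apply_le_one_of_transpose_mul_self {ι : Type*} [Fintype ι] [DecidableEq ι]
    {k : Matrix ι ι ℝ} (hk : kᵀ * k = 1) (i j : ι) : |k i j| ≤ 1 := by
  have hjj : ∑ l, k l j * k l j = 1 := by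
    simpa [mul_apply] using congrFun (congrFun hk j) j
  have hle : k i j * k i j ≤ ∑ l, k l j * k l j :=
    Finset.single_le_sum (f := fun l => k l j * k l j)
      (fun l _ => mul_self_nonneg _) (Finset.mem_univ i)
  rw [hjj] at hle
  exact abs_le_one_iff_mul_self_le_one.mpr hle

theorem quasiNorm_lt_of_abs_lt {k : ℕ} (hk : 0 < k) {α x : Fin k → ℝ} {ε : ℝ}
    (hε0 : 0 < ε) (hε1 : ε < 1) (hαpos : ∀ j, 0 < α j) (hα1 : ∑ j, α j = 1)
    (hx : ∀ j, |x j| < ε) : quasiNorm α x < ε := by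
  have : Nonempty (Fin k) := ⟨⟨0, hk⟩⟩
  obtain ⟨j, hj⟩ := exists_eq_ciSup_of_finite (f := fun j => |x j| ^ (1 / α j))
  rw [quasiNorm, ← hj]
  have hαle : α j ≤ 1 := hα1 ▸
    Finset.single_le_sum (fun l _ => (hαpos l).le) (Finset.mem_univ j)
  calc |x j| ^ (1 / α j) < ε ^ (1 / α j) :=
        Real.rpow_lt_rpow (abs_nonneg _) (hx j) (one_div_pos.mpr (hαpos j))
    _ ≤ ε ^ (1 : ℝ) :=
        Real.rpow_le_rpow_of_exponent_ge hε0 hε1.le (one_le_one_div (hαpos j) hαle)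
    _ = ε := Real.rpow_one ε

/-- The first column of `k * diagonal s * u` for an upper triangular unipotent matrix `u`. -/
theorem mul_diagonal_mul_apply_zero {d : ℕ} (hd : 0 < d) (k u : Matrix (Fin d) (Fin d) ℝ)
    (s : Fin d → ℝ) (hdiag : ∀ i, u i i = 1) (hlow : ∀ i j : Fin d, j < i → u i j = 0)
    (i : Fin d) : (k * diagonal s * u) i ⟨0, hd⟩ = k i ⟨0, hd⟩ * s ⟨0, hd⟩ := by
  rw [mul_apply, Finset.sum_eq_single (⟨0, hd⟩ : Fin d)]
  · rw [mul_diagonal, hdiag, mul_one]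
  · intro l _ hl
    have hpos : (⟨0, hd⟩ : Fin d) < l :=
      Fin.lt_def.mpr (Nat.pos_of_ne_zero fun h0 => hl (Fin.ext h0))
    rw [hlow _ _ hpos, mul_zero]
  · simp

/-- Lemma 2.1 of the paper: if `g γ Γ_N` meets `K ⬝ A_ε ⬝ U`, then some primitive
integer vector `w ≡ γ e₁ (mod N)` satisfies `‖g w‖_{α,β} < ε`. -/
theorem exists_primitive_congruent_of_mem_KAU (m n : ℕ) (hm : 0 < m) (hn : 0 < n)
    (N : ℕ) (hN : 0 < N) (ε : ℝ) (hε0 : 0 < ε) (hε1 : ε < 1)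
    (α : Fin m → ℝ) (hαpos : ∀ j, 0 < α j) (hα1 : ∑ j, α j = 1)
    (β : Fin n → ℝ) (hβpos : ∀ j, 0 < β j) (hβ1 : ∑ j, β j = 1)
    (g : Matrix (Fin (m + n)) (Fin (m + n)) ℝ) (hg : g.det = 1)
    (γ : Matrix (Fin (m + n)) (Fin (m + n)) ℤ) (hγ : γ.det = 1)
    (h : ∃ γt : Matrix (Fin (m + n)) (Fin (m + n)) ℤ, γt.det = 1 ∧
      (∀ i, γt.mulVec (stdE1 (m + n)) i ≡ stdE1 (m + n) i [ZMOD N]) ∧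
      ∃ k a u : Matrix (Fin (m + n)) (Fin (m + n)) ℝ,
        (kᵀ * k = 1 ∧ k.det = 1) ∧
        (∃ s : Fin (m + n) → ℝ, a = Matrix.diagonal s ∧ (∀ i, 0 < s i) ∧
          a.det = 1 ∧ ∀ i : Fin (m + n), (i : ℕ) = 0 → s i < ε) ∧
        ((∀ i, u i i = 1) ∧ ∀ i j : Fin (m + n), j < i → u i j = 0) ∧
        g * γ.map (Int.cast : ℤ → ℝ) * γt.map (Int.cast : ℤ → ℝ) = k * a * u) :
    ∃ w : Fin (m + n) → ℤ, w ≠ 0 ∧ Finset.univ.gcd w = 1 ∧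
      (∀ i, w i ≡ γ.mulVec (stdE1 (m + n)) i [ZMOD N]) ∧
      max (quasiNorm α fun j => g.mulVec (fun i => (w i : ℝ)) (Fin.castAdd n j))
          (quasiNorm β fun j => g.mulVec (fun i => (w i : ℝ)) (Fin.natAdd m j)) < ε := by
  obtain ⟨γt, hγt, hcong, k, a, u, ⟨hk, -⟩, ⟨s, rfl, hs0, -, hsε⟩, ⟨hdiag, hlow⟩, heq⟩ := h
  have hd : 0 < m + n := Nat.add_pos_left hm n
  set z : Fin (m + n) := ⟨0, hd⟩
  have hdet : (γ * γt).det = 1 := by rw [det_mul, hγ, hγt, one_mul]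
  have hgcd := gcd_col_eq_one_of_det_eq_one hdet z
  have hcol : (γ * γt).col z = γ.mulVec (γt.mulVec (stdE1 (m + n))) := by
    rw [mulVec_mulVec, stdE1_eq_single hd, mulVec_single_one]
  have hgw (i : Fin (m + n)) :
      g.mulVec (fun l => (((γ * γt).col z l : ℤ) : ℝ)) i = k i z * s z := by
    rw [← mul_diagonal_mul_apply_zero hd k u s hdiag hlow, ← heq, Matrix.mul_assoc]
    simp [mulVec, dotProduct, mul_apply, z]
  have hsmall (i : Fin (m + n)) :
      |g.mulVec (fun l => (((γ * γt).col z l : ℤ) : ℝ)) i| < ε := by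
    rw [hgw, abs_mul, abs_of_pos (hs0 z)]
    exact (mul_le_of_le_one_left (hs0 z).le
      (abs_apply_le_one_of_transpose_mul_self hk i z)).trans_lt (hsε z rfl)
  refine ⟨(γ * γt).col z, fun h0 => ?_, hgcd, fun i => ?_, max_lt ?_ ?_⟩
  · have hzero : Finset.univ.gcd ((γ * γt).col z) = 0 :=
      Finset.gcd_eq_zero_iff.mpr fun i _ => congrFun h0 i
    exact zero_ne_one (hzero.symm.trans hgcd)
  · rw [hcol]
    change ∑ l, γ i l * _ ≡ ∑ l, γ i l * _ [ZMOD N]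
    exact Int.ModEq.sum fun l _ => (hcong l).mul_left _
  · exact quasiNorm_lt_of_abs_lt hm hε0 hε1 hαpos hα1 fun j => hsmall _
  · exact quasiNorm_lt_of_abs_lt hn hε0 hε1 hβpos hβ1 fun j => hsmall _
end
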